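/- Let Ω ⊂ ℝⁿ be a bounded, smooth, convex domain, p > 1, and γ ∈ (1, 3/2) with q = 2γ−1 such that 1 − 4(γ−1)² > 0 and p(1 − 4(γ−1)²) + 8γ²(γ−1)²/((4γ+p−3)(p+1)) − γ²/(2γ−1) > 0. Then there exists a constant C > 0 (independent of u and λ) such that every λ > 0 and every stable classical solution u of Δ²u = λ(u+1)^p in Ω, u > 0 in Ω, u = Δu = 0 on ∂Ω, satisfies ( p(1 − 4(γ−1)²) + 8γ²(γ−1)²/((4γ+p−3)(p+1)) − γ²/(2γ−1) ) ∫_Ω (u+1)^{p+q} dx ≤ C/λ. -/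

import Mathlib

open MeasureTheory Real RealInnerProductSpace

/-- The Laplacian of `f : ℝⁿ → ℝ`, as the trace of the second derivative. -/
noncomputable def lap {n : ℕ} (f : EuclideanSpace ℝ (Fin n) → ℝ)
    (x : EuclideanSpace ℝ (Fin n)) : ℝ :=
  ∑ i : Fin n,
    iteratedFDeriv ℝ 2 f x ![EuclideanSpace.single i 1, EuclideanSpace.single i 1]

/-- Squared Frobenius norm of the Hessian of `f : ℝⁿ → ℝ`. -/
noncomputable def hessNormSq {n : ℕ} (f : EuclideanSpace ℝ (Fin n) → ℝ)
    (x : EuclideanSpace ℝ (Fin n)) : ℝ :=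
  ∑ i : Fin n, ∑ j : Fin n,
    (iteratedFDeriv ℝ 2 f x ![EuclideanSpace.single i 1, EuclideanSpace.single j 1]) ^ 2

/-- The quantity `‖∇⁴(φ^{2γ})‖` defined by
`‖∇⁴(φ^{2γ})‖² = φ^{-2γ}|∇φ^γ|⁴ + |φ^γ Δ²φ^γ| + |∇²φ^γ|²`,
with the first term interpreted as `0` where `φ = 0`. -/
noncomputable def norm4 {n : ℕ} (γ : ℝ) (φ : EuclideanSpace ℝ (Fin n) → ℝ)
    (x : EuclideanSpace ℝ (Fin n)) : ℝ :=
  Real.sqrt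
    ((if φ x = 0 then 0 else φ x ^ (-(2*γ)) * ‖gradient (fun y => φ y ^ γ) x‖ ^ 4)
      + |φ x ^ γ * lap (lap (fun y => φ y ^ γ)) x|
      + hessNormSq (fun y => φ y ^ γ) x)

/-- `u` is a stable classical solution of the Navier problem
`Δ²u = lam (u+1)^p` in `Ω`, `u > 0` in `Ω`, `u = Δu = 0` on `∂Ω`; stability is
tested on smooth functions vanishing on `∂Ω` (dense in `H²(Ω) ∩ H¹₀(Ω)`). -/
def IsStableSol {n : ℕ} (Ω : Set (EuclideanSpace ℝ (Fin n))) (p lam : ℝ)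
    (u : EuclideanSpace ℝ (Fin n) → ℝ) : Prop :=
  ContDiff ℝ 4 u ∧ (∀ x ∈ Ω, 0 < u x) ∧
    (∀ x ∈ Ω, lap (lap u) x = lam * (u x + 1) ^ p) ∧
    (∀ x ∈ frontier Ω, u x = 0 ∧ lap u x = 0) ∧
    (∀ φ : EuclideanSpace ℝ (Fin n) → ℝ, ContDiff ℝ (⊤ : ℕ∞) φ →
      (∀ x ∈ frontier Ω, φ x = 0) →
      lam * p * ∫ x in Ω, (u x + 1) ^ (p - 1) * φ x ^ 2 ≤ ∫ x in Ω, (lap φ x) ^ 2)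

/-- The partial derivative of `f` in the `i`-th coordinate direction. -/
noncomputable def pderiv {n : ℕ} (i : Fin n) (f : EuclideanSpace ℝ (Fin n) → ℝ)
    (x : EuclideanSpace ℝ (Fin n)) : ℝ :=
  fderiv ℝ f x (EuclideanSpace.single i 1)

section PartialDerivatives

variable {n : ℕ} {f g : EuclideanSpace ℝ (Fin n) → ℝ} {x : EuclideanSpace ℝ (Fin n)}

lemma ContDiff.pderiv {m k : WithTop ℕ∞} (hf : ContDiff ℝ m f) (h : k + 1 ≤ m) (i : Fin n) :
    ContDiff ℝ k (pderiv i f) :=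
  (hf.fderiv_right h).clm_apply contDiff_const

lemma pderiv_pderiv_eq_iteratedFDeriv (hf : ContDiff ℝ 2 f) (i j : Fin n) :
    pderiv i (pderiv j f) x =
      iteratedFDeriv ℝ 2 f x ![EuclideanSpace.single i 1, EuclideanSpace.single j 1] := by
  have h : DifferentiableAt ℝ (fderiv ℝ f) x :=
    ((hf.fderiv_right (m := 1) (by norm_num)).differentiable (by norm_num)) x
  rw [iteratedFDeriv_two_apply]
  unfold _root_.pderiv
  rw [fderiv_clm_apply h (by fun_prop)]
  simp

lemma lap_eq_sum_pderiv (hf : ContDiff ℝ 2 f) : lap f = fun x => ∑ i, pderiv i (pderiv i f) x := by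
  ext x
  simp only [lap, pderiv_pderiv_eq_iteratedFDeriv hf]

lemma ContDiff.lap {m k : WithTop ℕ∞} (hf : ContDiff ℝ m f) (h : k + 2 ≤ m) :
    ContDiff ℝ k (lap f) := by
  have h' : k + 1 + 1 ≤ m := by rw [add_assoc]; exact h
  rw [lap_eq_sum_pderiv (hf.of_le (le_trans (by simp) h))]
  exact ContDiff.sum fun i _ => (hf.pderiv h' i).pderiv le_rfl i

lemma pderiv_comm (hf : ContDiff ℝ 2 f) (i j : Fin n) :
    pderiv i (pderiv j f) = pderiv j (pderiv i f) := by
  ext x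
  rw [pderiv_pderiv_eq_iteratedFDeriv hf, pderiv_pderiv_eq_iteratedFDeriv hf,
    iteratedFDeriv_two_apply, iteratedFDeriv_two_apply]
  exact (hf.contDiffAt.isSymmSndFDerivAt (by simp)) _ _

lemma norm_iteratedFDeriv_pderiv_le {m : ℕ} (hf : ContDiff ℝ (m + 1 : ℕ) f) (i : Fin n) :
    ‖iteratedFDeriv ℝ m (pderiv i f) x‖ ≤ ‖iteratedFDeriv ℝ (m + 1) f x‖ := by
  have h := (ContinuousLinearMap.apply ℝ ℝ
    (EuclideanSpace.single i (1 : ℝ))).norm_iteratedFDeriv_comp_left (𝕜 := ℝ)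
    (f := fderiv ℝ f) (x := x) (n := m) (N := m) (hf.fderiv_right (by simp)).contDiffAt le_rfl
  have h1 : ‖ContinuousLinearMap.apply ℝ ℝ (EuclideanSpace.single i (1 : ℝ))‖ ≤ 1 :=
    ContinuousLinearMap.opNorm_le_bound _ zero_le_one fun L => by
      simpa using L.le_opNorm (EuclideanSpace.single i (1 : ℝ))
  rw [norm_iteratedFDeriv_fderiv] at h
  exact h.trans (mul_le_of_le_one_left (norm_nonneg _) h1)

lemma abs_pderiv_le (hf : ContDiff ℝ 1 f) (i : Fin n) :
    |pderiv i f x| ≤ ‖iteratedFDeriv ℝ 1 f x‖ := by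
  simpa using norm_iteratedFDeriv_pderiv_le (m := 0) (x := x) (by simpa using hf) i

lemma abs_pderiv_pderiv_le (hf : ContDiff ℝ 2 f) (i j : Fin n) :
    |pderiv i (pderiv j f) x| ≤ ‖iteratedFDeriv ℝ 2 f x‖ :=
  (abs_pderiv_le (hf.pderiv (by norm_num) j) i).trans
    (norm_iteratedFDeriv_pderiv_le (m := 1) (by simpa using hf) j)

lemma abs_pderiv_pderiv_pderiv_le (hf : ContDiff ℝ 3 f) (i j k : Fin n) :
    |pderiv i (pderiv j (pderiv k f)) x| ≤ ‖iteratedFDeriv ℝ 3 f x‖ :=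
  (abs_pderiv_pderiv_le (hf.pderiv (by norm_num) k) i j).trans
    (norm_iteratedFDeriv_pderiv_le (m := 2) (by simpa using hf) k)

lemma pderiv_sub (hf : DifferentiableAt ℝ f x) (hg : DifferentiableAt ℝ g x) (i : Fin n) :
    pderiv i (fun y => f y - g y) x = pderiv i f x - pderiv i g x := by
  simp [pderiv, fderiv_fun_sub hf hg]

lemma pderiv_mul (hf : DifferentiableAt ℝ f x) (hg : DifferentiableAt ℝ g x) (i : Fin n) :
    pderiv i (fun y => f y * g y) x = pderiv i f x * g x + f x * pderiv i g x := by
  simp [pderiv, fderiv_fun_mul hf hg]; ring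

lemma pderiv_const_mul (hf : DifferentiableAt ℝ f x) (c : ℝ) (i : Fin n) :
    pderiv i (fun y => c * f y) x = c * pderiv i f x := by
  simp [pderiv, fderiv_const_mul hf]

lemma pderiv_sum {ι : Type*} {s : Finset ι} {F : ι → EuclideanSpace ℝ (Fin n) → ℝ}
    (hF : ∀ j ∈ s, DifferentiableAt ℝ (F j) x) (i : Fin n) :
    pderiv i (fun y => ∑ j ∈ s, F j y) x = ∑ j ∈ s, pderiv i (F j) x := by
  simp [pderiv, fderiv_fun_sum hF]

lemma pderiv_rpow (hf : DifferentiableAt ℝ f x) (h0 : f x ≠ 0) (s : ℝ) (i : Fin n) :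
    pderiv i (fun y => f y ^ s) x = s * f x ^ (s - 1) * pderiv i f x := by
  have := (hf.hasFDerivAt.rpow_const (p := s) (Or.inl h0)).fderiv
  simp [pderiv, this]

lemma Filter.EventuallyEq.lap_eq (h : f =ᶠ[nhds x] g) : lap f x = lap g x := by
  simp [_root_.lap, (h.iteratedFDeriv ℝ 2).eq_of_nhds]

end PartialDerivatives

section Divergence

lemma eq_Ioo_csInf_csSup_of_isOpen {S : Set ℝ} (ho : IsOpen S) (hc : S.OrdConnected)
    (hb : Bornology.IsBounded S) (hne : S.Nonempty) :
    S = Set.Ioo (sInf S) (sSup S) ∧ sInf S ∉ S ∧ sSup S ∉ S := by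
  have hba := hb.bddAbove
  have hbb := hb.bddBelow
  have h1 : sInf S ∉ S := fun h => by
    obtain ⟨y, hy, hyS⟩ := (mem_nhds_iff_exists_Ioo_subset.1 (ho.mem_nhds h)).imp fun _ h => h
    obtain ⟨z, hz1, hz2⟩ := exists_between hyS.1.1
    exact absurd (csInf_le hbb (hyS.2 ⟨hz1, hz2.trans hyS.1.2⟩)) (not_le.2 hz2)
  have h2 : sSup S ∉ S := fun h => by
    obtain ⟨y, hy, hyS⟩ := (mem_nhds_iff_exists_Ioo_subset.1 (ho.mem_nhds h)).imp fun _ h => h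
    obtain ⟨z, hz1, hz2⟩ := exists_between hyS.1.2
    exact absurd (le_csSup hba (hyS.2 ⟨hyS.1.1.trans hz1, hz2⟩)) (not_le.2 hz1)
  refine ⟨Set.Subset.antisymm (fun x hx => ⟨?_, ?_⟩) ?_, h1, h2⟩
  · exact lt_of_le_of_ne (csInf_le hbb hx) fun h => h1 (h ▸ hx)
  · exact lt_of_le_of_ne (le_csSup hba hx) fun h => h2 (h ▸ hx)
  · exact IsConnected.Ioo_csInf_csSup_subset ⟨hne, hc.isPreconnected⟩ hbb hba

variable {n : ℕ} {Ω : Set (EuclideanSpace ℝ (Fin n))}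

lemma abs_setIntegral_line_le (ho : IsOpen Ω) (hb : Bornology.IsBounded Ω) (hc : Convex ℝ Ω)
    {F : EuclideanSpace ℝ (Fin n) → ℝ} (hF : ContDiff ℝ 1 F) {M : ℝ} (hM0 : 0 ≤ M)
    (hM : ∀ x ∈ frontier Ω, |F x| ≤ M) (i : Fin n) (c : EuclideanSpace ℝ (Fin n)) :
    |∫ t in {t : ℝ | c + t • EuclideanSpace.single i (1 : ℝ) ∈ Ω},
      pderiv i F (c + t • EuclideanSpace.single i (1 : ℝ))| ≤ 2 * M := by
  set e : EuclideanSpace ℝ (Fin n) := EuclideanSpace.single i (1 : ℝ) with he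
  set S : Set ℝ := {t : ℝ | c + t • e ∈ Ω} with hS
  have hcont : Continuous fun t : ℝ => c + t • e := by fun_prop
  rcases S.eq_empty_or_nonempty with hE | hne
  · rw [hE]; simpa using hM0
  have hSo : IsOpen S := ho.preimage hcont
  have hSc : Convex ℝ S := by
    intro a ha b hb' s t hs ht hst
    have h := hc ha hb' hs ht hst
    have h' : s • (c + a • e) + t • (c + b • e) = c + (s • a + t • b) • e := by
      rw [smul_add, smul_add, add_add_add_comm, ← add_smul, hst, one_smul, add_smul, smul_smul,
        smul_smul]; simp
    rw [h'] at h
    exact h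
  have hSb : Bornology.IsBounded S := by
    obtain ⟨R, hR⟩ := hb.exists_norm_le
    refine (isBounded_iff_forall_norm_le).2 ⟨R + ‖c‖, fun t ht => ?_⟩
    have h1 := hR _ ht
    have h2 : ‖t • e‖ = ‖t‖ := by rw [norm_smul, he]; simp
    have h3 : ‖t • e‖ ≤ ‖c + t • e‖ + ‖c‖ := by
      simpa using norm_sub_le (c + t • e) c
    linarith
  obtain ⟨hIoo, hi, hs⟩ := eq_Ioo_csInf_csSup_of_isOpen hSo hSc.ordConnected hSb hne
  have hfr : ∀ t ∈ closure S, t ∉ S → c + t • e ∈ frontier Ω := fun t ht htS => by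
    rw [ho.frontier_eq]
    exact ⟨map_mem_closure (f := fun t : ℝ => c + t • e) hcont ht fun _ h => h, htS⟩
  have ha := hM _ (hfr _ (csInf_mem_closure hne hSb.bddBelow) hi)
  have hb' := hM _ (hfr _ (csSup_mem_closure hne hSb.bddAbove) hs)
  have hle : sInf S ≤ sSup S := csInf_le_csSup hne hSb.bddBelow hSb.bddAbove
  rw [hIoo, ← integral_Ioc_eq_integral_Ioo, ← intervalIntegral.integral_of_le hle,
    intervalIntegral.integral_eq_sub_of_hasDerivAt (f := fun t => F (c + t • e))]
  · rw [abs_le] at *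
    constructor <;> linarith [ha.1, ha.2, hb'.1, hb'.2]
  · intro t _
    have h1 : HasDerivAt (fun t : ℝ => c + t • e) e t := by
      simpa using ((hasDerivAt_id t).smul_const e).const_add c
    exact ((hF.differentiable one_ne_zero _).hasFDerivAt.comp_hasDerivAt t h1)
  · exact (((hF.pderiv (k := 0) (by simp) i).continuous).comp hcont).intervalIntegrable _ _

/-- On a bounded convex domain, the integral of a partial derivative is controlled by the
boundary values. -/
lemma exists_abs_setIntegral_pderiv_le (ho : IsOpen Ω) (hb : Bornology.IsBounded Ω)
    (hc : Convex ℝ Ω) (i : Fin n) :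
    ∃ K : ℝ, 0 ≤ K ∧ ∀ F : EuclideanSpace ℝ (Fin n) → ℝ, ContDiff ℝ 1 F → ∀ M : ℝ, 0 ≤ M →
      (∀ x ∈ frontier Ω, |F x| ≤ M) → |∫ x in Ω, pderiv i F x| ≤ K * M := by
  obtain ⟨m, rfl⟩ : ∃ m, n = m + 1 := ⟨n - 1, by have := i.pos; omega⟩
  obtain ⟨R, hR⟩ := hb.exists_norm_le
  set B : Set (Fin m → ℝ) := Metric.closedBall 0 R
  have hBfin : volume B ≠ ⊤ := measure_closedBall_lt_top.ne
  refine ⟨2 * volume.real B, by positivity, fun F hF M hM0 hM => ?_⟩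
  set e : EuclideanSpace ℝ (Fin (m + 1)) := EuclideanSpace.single i (1 : ℝ) with he
  set A : ℝ × (Fin m → ℝ) ≃ᵐ EuclideanSpace ℝ (Fin (m + 1)) :=
    (MeasurableEquiv.piFinSuccAbove (fun _ => ℝ) i).symm.trans
      (MeasurableEquiv.toLp 2 (Fin (m + 1) → ℝ)) with hA
  have hAmp : MeasurePreserving A (volume.prod volume) volume :=
    (EuclideanSpace.volume_preserving_symm_measurableEquiv_toLp (Fin (m + 1))).symm.comp
      (volume_preserving_piFinSuccAbove (fun _ => ℝ) i).symm
  have hAval : ∀ t y, A (t, y) = WithLp.toLp 2 (i.insertNth (α := fun _ => ℝ) t y) :=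
    fun _ _ => rfl
  have hAapp : ∀ t y, A (t, y) = A (0, y) + t • e := by
    intro t y
    ext j
    rcases Fin.eq_self_or_eq_succAbove i j with rfl | ⟨k, rfl⟩
    · simp [hAval, he]
    · simp [hAval, he]
  have hAnorm : ∀ t y, ‖y‖ ≤ ‖A (t, y)‖ := by
    intro t y
    refine (pi_norm_le_iff_of_nonneg (norm_nonneg _)).2 fun k => ?_
    have h := PiLp.norm_apply_le (A (t, y)) (i.succAbove k)
    simpa [hAval] using h
  have hcont := (hF.pderiv (k := 0) (by simp) i).continuous
  have hintF : IntegrableOn (pderiv i F) Ω :=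
    (hcont.continuousOn.integrableOn_compact hb.isCompact_closure).mono_set subset_closure
  have hintA : Integrable (fun z => Ω.indicator (pderiv i F) (A z)) (volume.prod volume) :=
    hAmp.integrable_comp_of_integrable ((integrable_indicator_iff ho.measurableSet).2 hintF)
  have hinner : ∀ y,
      |∫ t, Ω.indicator (pderiv i F) (A (t, y))| ≤ B.indicator (fun _ => 2 * M) y := by
    intro y
    have h1 : ∀ t, Ω.indicator (pderiv i F) (A (t, y)) =
        Set.indicator {t : ℝ | A (0, y) + t • e ∈ Ω}
          (fun t => pderiv i F (A (0, y) + t • e)) t := by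
      intro t
      rw [hAapp t y]
      rfl
    have hmeas : MeasurableSet {t : ℝ | A (0, y) + t • e ∈ Ω} :=
      (ho.preimage (by fun_prop : Continuous fun t : ℝ => A (0, y) + t • e)).measurableSet
    by_cases hy : y ∈ B
    · simp_rw [h1]
      rw [integral_indicator hmeas, Set.indicator_of_mem hy]
      exact abs_setIntegral_line_le ho hb hc hF hM0 hM i _
    · have h2 : ∀ t, Ω.indicator (pderiv i F) (A (t, y)) = 0 := fun t =>
        Set.indicator_of_notMem (fun h => hy (by
          simpa [B] using (hAnorm t y).trans (hR _ h))) _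
      simp [h2, hy]
  rw [← integral_indicator ho.measurableSet, ← hAmp.integral_comp A.measurableEmbedding,
    integral_prod_symm _ hintA]
  refine (norm_integral_le_of_norm_le (g := B.indicator fun _ => 2 * M) ?_
    (Filter.Eventually.of_forall fun y => (Real.norm_eq_abs _).trans_le (hinner y))).trans_eq ?_
  · exact (integrable_indicator_iff measurableSet_closedBall).2 (integrableOn_const hBfin)
  · rw [integral_indicator measurableSet_closedBall, setIntegral_const, smul_eq_mul]
    ring

/-- On a bounded convex domain, the integral of a divergence is controlled by the boundary
values of the field. -/
lemma exists_abs_setIntegral_div_le (ho : IsOpen Ω) (hb : Bornology.IsBounded Ω)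
    (hc : Convex ℝ Ω) :
    ∃ K : ℝ, 0 ≤ K ∧ ∀ F : Fin n → EuclideanSpace ℝ (Fin n) → ℝ, (∀ i, ContDiff ℝ 1 (F i)) →
      ∀ M : ℝ, 0 ≤ M → (∀ i, ∀ x ∈ frontier Ω, |F i x| ≤ M) →
      |∫ x in Ω, ∑ i, pderiv i (F i) x| ≤ K * M := by
  choose K hK0 hK using fun i => exists_abs_setIntegral_pderiv_le ho hb hc i
  refine ⟨∑ i, K i, Finset.sum_nonneg fun i _ => hK0 i, fun F hF M hM0 hM => ?_⟩
  rw [integral_finsetSum, Finset.sum_mul]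
  · exact (Finset.abs_sum_le_sum_abs _ _).trans
      (Finset.sum_le_sum fun i _ => hK i (F i) (hF i) M hM0 (hM i))
  · intro i _
    exact (((hF i).pderiv (k := 0) (by simp) i).continuous.continuousOn.integrableOn_compact
      hb.isCompact_closure).mono_set subset_closure

end Divergence

section Retraction

variable {E : Type*} [NormedAddCommGroup E] [InnerProductSpace ℝ E] [CompleteSpace E]

/-- The gradient of a defining function of a convex set points away from interior points. -/
lemma fderiv_apply_sub_pos_of_convex {S : Set E} {f : E → ℝ} (ho : IsOpen S) (hc : Convex ℝ S)
    {x₀ : E} (h0 : x₀ ∈ S) (hf : Differentiable ℝ f) (hS : S = f ⁻¹' Set.Iio 0) {y : E}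
    (hy : f y = 0) (hgrad : gradient f y ≠ 0) (hcl : y ∈ closure S) :
    0 < fderiv ℝ f y (y - x₀) := by
  have hle : ∀ z ∈ S, fderiv ℝ f y (z - y) ≤ 0 := by
    intro z hz
    have h1 : HasDerivAt (fun t : ℝ => f (y + t • (z - y))) (fderiv ℝ f y (z - y)) 0 := by
      have h2 : HasDerivAt (fun t : ℝ => y + t • (z - y)) (z - y) 0 := by
        simpa using ((hasDerivAt_id (0 : ℝ)).smul_const (z - y)).const_add y
      have h3 : HasFDerivAt f (fderiv ℝ f y) (y + (0 : ℝ) • (z - y)) := by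
        simpa using (hf y).hasFDerivAt
      exact h3.comp_hasDerivAt 0 h2
    refine le_of_tendsto h1.tendsto_slope_zero_right ?_
    filter_upwards [Ioo_mem_nhdsGT (zero_lt_one' ℝ)] with t ht
    have hmem : y + t • (z - y) ∈ S := by
      have h := hc.combo_interior_closure_mem_interior (ho.interior_eq.symm ▸ hz) hcl
        ht.1 (sub_nonneg.2 ht.2.le) (by ring : t + (1 - t) = 1)
      rw [ho.interior_eq] at h
      convert h using 1
      module
    rw [hS] at hmem
    have hneg : f (y + t • (z - y)) < 0 := hmem
    simp only [zero_add, zero_smul, add_zero, hy, sub_zero, smul_eq_mul]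
    exact mul_nonpos_of_nonneg_of_nonpos (inv_nonneg.2 ht.1.le) hneg.le
  have hz := hle x₀ h0
  rw [← neg_sub, map_neg, Left.neg_nonpos_iff] at hz
  refine lt_of_le_of_ne hz fun heq => hgrad ?_
  have hcont : Filter.Tendsto (fun t : ℝ => x₀ + t • gradient f y) (nhdsWithin 0 (Set.Ioi 0))
      (nhds x₀) := by
    have : Continuous fun t : ℝ => x₀ + t • gradient f y := by fun_prop
    simpa using (this.tendsto 0).mono_left nhdsWithin_le_nhds
  obtain ⟨t, ht, ht0⟩ := ((hcont.eventually (ho.mem_nhds h0)).and self_mem_nhdsWithin).exists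
  have h := hle _ ht
  have hg : fderiv ℝ f y (gradient f y) = ‖gradient f y‖ ^ 2 := by
    rw [gradient, ← InnerProductSpace.toDual_symm_apply, real_inner_self_eq_norm_sq]
  have h2 : x₀ + t • gradient f y - y = t • gradient f y - (y - x₀) := by abel
  rw [h2, map_sub, map_smul, ← heq, sub_zero, hg, smul_eq_mul] at h
  have h3 : ‖gradient f y‖ ^ 2 ≤ 0 := nonpos_of_mul_nonpos_right h ht0
  simpa using le_antisymm h3 (sq_nonneg _)

lemma contDiffAt_gauge {S : Set E} {f : E → ℝ} (ho : IsOpen S) (hb : Bornology.IsBounded S)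
    (hc : Convex ℝ S) (h0 : (0 : E) ∈ S) (hf : ContDiff ℝ (⊤ : ℕ∞) f) (hS : S = f ⁻¹' Set.Iio 0)
    (hfr : frontier S = f ⁻¹' {0}) (hgrad : ∀ x ∈ frontier S, gradient f x ≠ 0)
    {x : E} (hx : x ≠ 0) : ContDiffAt ℝ (⊤ : ℕ∞) (gauge S) x := by
  have hS0 : S ∈ nhds (0 : E) := ho.mem_nhds h0
  have hpos : ∀ y : E, y ≠ 0 → 0 < gauge S y := fun y hy =>
    (gauge_pos (absorbent_nhds_zero hS0) (NormedSpace.isVonNBounded_of_isBounded ℝ hb)).2 hy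
  have hzero : ∀ y : E, y ≠ 0 → (gauge S y)⁻¹ • y ∈ frontier S := fun y hy => by
    rw [← gauge_eq_one_iff_mem_frontier hc hS0,
      gauge_smul_of_nonneg (inv_nonneg.2 (hpos y hy).le), smul_eq_mul,
      inv_mul_cancel₀ (hpos y hy).ne']
  have hfzero : ∀ y : E, y ≠ 0 → f ((gauge S y)⁻¹ • y) = 0 := fun y hy => by
    have := hzero y hy
    rwa [hfr] at this
  set G : E × ℝ → ℝ := fun v => f (v.2 • v.1) with hG
  set s := (gauge S x)⁻¹ with hs
  have hs0 : 0 < s := inv_pos.2 (hpos x hx)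
  have hGc : ContDiff ℝ (⊤ : ℕ∞) G := hf.comp (contDiff_snd.smul contDiff_fst)
  have hd : (fderiv ℝ G (x, s) ∘L .inr ℝ E ℝ) 1 = fderiv ℝ f (s • x) x := by
    have h1 : HasDerivAt (fun t : ℝ => G (x, t)) (fderiv ℝ G (x, s) (0, 1)) s :=
      ((hGc.differentiable (by simp)) (x, s)).hasFDerivAt.comp_hasDerivAt s
        ((hasDerivAt_const s x).prodMk (hasDerivAt_id s))
    have h2 : HasDerivAt (fun t : ℝ => G (x, t)) (fderiv ℝ f (s • x) x) s := by
      have h3 : HasDerivAt (fun t : ℝ => t • x) x s := by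
        simpa using (hasDerivAt_id s).smul_const x
      exact ((hf.differentiable (by simp)) (s • x)).hasFDerivAt.comp_hasDerivAt s h3
    simpa using h1.unique h2
  have hdpos : 0 < fderiv ℝ f (s • x) x := by
    have h := fderiv_apply_sub_pos_of_convex ho hc h0 (hf.differentiable (by simp)) hS
      (hfzero x hx) (hgrad _ (hzero x hx)) (frontier_subset_closure (hzero x hx))
    rw [sub_zero, map_smul, smul_eq_mul] at h
    exact pos_of_mul_pos_right h hs0.le
  have hinv : (fderiv ℝ G (x, s) ∘L .inr ℝ E ℝ).IsInvertible := by
    refine ⟨ContinuousLinearEquiv.unitsEquivAut ℝ (Units.mk0 _ hdpos.ne'), ?_⟩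
    ext
    rw [hd]
    simp
  have hGat : ContDiffAt ℝ (⊤ : ℕ∞) G (x, s) := hGc.contDiffAt
  have hcont : Filter.Tendsto (fun y => (y, (gauge S y)⁻¹)) (nhds x) (nhds (x, s)) :=
    Filter.tendsto_id.prodMk_nhds
      (((continuous_gauge hc hS0).tendsto x).inv₀ (hpos x hx).ne')
  have hev : ∀ᶠ y in nhds x, gauge S y = (hGat.implicitFunction (by simp) hinv y)⁻¹ := by
    filter_upwards [hcont.eventually (hGat.eventually_apply_eq_iff_implicitFunction (by simp) hinv),
      isOpen_ne.mem_nhds hx] with y hy hy0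
    have h := hy.1 (by simp only [hG]; rw [hfzero y hy0, hfzero x hx])
    rw [h, inv_inv]
  refine ContDiffAt.congr_of_eventuallyEq ?_ hev
  refine (hGat.contDiffAt_implicitFunction (by simp) hinv).inv ?_
  have := hGat.implicitFunction_apply_self (by simp) hinv
  exact this.trans_ne hs0.ne'

end Retraction

/-- A smooth bounded convex domain admits a smooth retraction onto its boundary, defined on the
support of a smooth function equal to one on the boundary. -/
lemma exists_smooth_retraction {n : ℕ} {Ω : Set (EuclideanSpace ℝ (Fin n))} (ho : IsOpen Ω)
    (hb : Bornology.IsBounded Ω) (hc : Convex ℝ Ω)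
    (hsmooth : ∃ f : EuclideanSpace ℝ (Fin n) → ℝ, ContDiff ℝ (⊤ : ℕ∞) f ∧
      Ω = f ⁻¹' Set.Iio 0 ∧ frontier Ω = f ⁻¹' {0} ∧
      ∀ x ∈ frontier Ω, gradient f x ≠ 0) (hne : Ω.Nonempty) :
    ∃ (χ : EuclideanSpace ℝ (Fin n) → ℝ) (P : EuclideanSpace ℝ (Fin n) → EuclideanSpace ℝ (Fin n)),
      ContDiff ℝ (⊤ : ℕ∞) χ ∧ ContDiff ℝ (⊤ : ℕ∞) P ∧
      (∀ x ∈ frontier Ω, χ x = 1 ∧ P x = x) ∧ ∀ x, χ x ≠ 0 → P x ∈ frontier Ω := by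
  obtain ⟨f, hf, hΩ, hfr, hgrad⟩ := hsmooth
  obtain ⟨x₀, hx₀⟩ := hne
  set S : Set (EuclideanSpace ℝ (Fin n)) := (fun x => x₀ + x) ⁻¹' Ω with hS
  have hcont : Continuous fun x : EuclideanSpace ℝ (Fin n) => x₀ + x := by fun_prop
  have hSo : IsOpen S := ho.preimage hcont
  have hS0 : (0 : EuclideanSpace ℝ (Fin n)) ∈ S := by simpa [hS] using hx₀
  have hSfr : frontier S = (fun x => x₀ + x) ⁻¹' frontier Ω :=
    ((Homeomorph.addLeft x₀).preimage_frontier Ω).symm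
  have hSb : Bornology.IsBounded S := by
    obtain ⟨R, hR⟩ := hb.exists_norm_le
    refine isBounded_iff_forall_norm_le.2 ⟨R + ‖x₀‖, fun x hx => ?_⟩
    have h := norm_sub_le (x₀ + x) x₀
    rw [add_sub_cancel_left] at h
    exact h.trans (by gcongr; exact hR _ hx)
  have hSc : Convex ℝ S := hc.translate_preimage_right x₀
  have hSN : S ∈ nhds (0 : EuclideanSpace ℝ (Fin n)) := hSo.mem_nhds hS0
  have hgauge : ∀ y ≠ 0, ContDiffAt ℝ (⊤ : ℕ∞) (gauge S) y := fun y hy => by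
    refine contDiffAt_gauge (f := fun x => f (x₀ + x)) hSo hSb hSc hS0
      (hf.comp (contDiff_const.add contDiff_id)) ?_ ?_ ?_ hy
    · rw [hS, hΩ]; rfl
    · rw [hSfr, hfr]; rfl
    · intro z hz
      rw [hSfr] at hz
      rw [gradient, fderiv_comp_add_left]
      exact hgrad _ hz
  have hpos : ∀ y ≠ 0, 0 < gauge S y := fun y hy =>
    (gauge_pos (absorbent_nhds_zero hSN) (NormedSpace.isVonNBounded_of_isBounded ℝ hSb)).2 hy
  obtain ⟨r, hr, hrΩ⟩ := Metric.isOpen_iff.1 ho x₀ hx₀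
  let b₁ : ContDiffBump x₀ := ⟨r / 2, r, by linarith, by linarith⟩
  let b₂ : ContDiffBump x₀ := ⟨r / 4, r / 2, by linarith, by linarith⟩
  have hdist : ∀ x ∈ frontier Ω, r ≤ dist x x₀ := fun x hx => by
    by_contra! h
    rw [ho.frontier_eq] at hx
    exact hx.2 (hrΩ h)
  have hb₂ : ∀ x, r / 2 ≤ dist x x₀ → b₂ x = 0 := fun x hx => b₂.zero_of_le_dist hx
  refine ⟨fun x => 1 - b₁ x, fun x => x₀ + ((1 - b₂ x) * (gauge S (x - x₀))⁻¹) • (x - x₀),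
    contDiff_const.sub b₁.contDiff, ?_, ?_, ?_⟩
  · rw [contDiff_iff_contDiffAt]
    intro x
    by_cases hx : x = x₀
    · have hev : (fun x => x₀ + ((1 - b₂ x) * (gauge S (x - x₀))⁻¹) • (x - x₀))
          =ᶠ[nhds x] fun _ => x₀ := by
        rw [hx]
        filter_upwards [b₂.eventuallyEq_one] with y hy
        simp [hy]
      exact contDiffAt_const.congr_of_eventuallyEq hev
    · have hx' : x - x₀ ≠ 0 := sub_ne_zero.2 hx
      have hsub : ContDiffAt ℝ (⊤ : ℕ∞) (fun y => y - x₀) x := contDiffAt_id.sub contDiffAt_const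
      have hg' : ContDiffAt ℝ (⊤ : ℕ∞) (fun y => gauge S (y - x₀)) x :=
        ContDiffAt.comp (g := gauge S) x (hgauge _ hx') hsub
      have hg : ContDiffAt ℝ (⊤ : ℕ∞) (fun y => (gauge S (y - x₀))⁻¹) x :=
        hg'.inv (hpos _ hx').ne'
      have hb : ContDiffAt ℝ (⊤ : ℕ∞) (fun y => 1 - b₂ y) x :=
        contDiffAt_const.sub b₂.contDiff.contDiffAt
      exact contDiffAt_const.add ((hb.mul hg).smul hsub)
  · intro x hx
    have hd := hdist x hx
    have h1 : gauge S (x - x₀) = 1 := by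
      rw [gauge_eq_one_iff_mem_frontier hSc hSN, hSfr]
      simpa using hx
    refine ⟨by beta_reduce; rw [b₁.zero_of_le_dist hd, sub_zero], ?_⟩
    beta_reduce
    rw [hb₂ x (by linarith), h1]
    simp
  · intro x hx
    have hd : r / 2 < dist x x₀ := by
      by_contra! h
      exact hx (by simp [b₁.one_of_mem_closedBall h])
    have hne : x - x₀ ≠ 0 := fun h => by
      rw [sub_eq_zero.1 h, dist_self] at hd
      linarith
    have h1 : (gauge S (x - x₀))⁻¹ • (x - x₀) ∈ frontier S := by
      rw [← gauge_eq_one_iff_mem_frontier hSc hSN,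
        gauge_smul_of_nonneg (inv_nonneg.2 (hpos _ hne).le), smul_eq_mul,
        inv_mul_cancel₀ (hpos _ hne).ne']
    rw [hSfr] at h1
    beta_reduce
    rw [hb₂ x hd.le]
    simpa using h1

lemma norm_iteratedFDeriv_two_eq {E F : Type*} [NormedAddCommGroup E] [NormedSpace ℝ E]
    [NormedAddCommGroup F] [NormedSpace ℝ F] (f : E → F) (x : E) :
    ‖iteratedFDeriv ℝ 2 f x‖ = ‖fderiv ℝ (fderiv ℝ f) x‖ := by
  rw [← norm_iteratedFDeriv_fderiv, ← norm_iteratedFDeriv_fderiv, norm_iteratedFDeriv_zero]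

section Approximation

variable {E F : Type*} [NormedAddCommGroup E] [NormedSpace ℝ E]
  [MeasurableSpace E] [BorelSpace E] [NormedAddCommGroup F] [NormedSpace ℝ F]

open scoped Convolution

lemma fderiv_convolution_lsmul {μ : Measure E} [SFinite μ]
    [μ.IsAddLeftInvariant] {ρ : E → ℝ} {g : E → F}
    (hρ : LocallyIntegrable ρ μ) (hg : ContDiff ℝ 1 g) (hgc : HasCompactSupport g) :
    fderiv ℝ (ρ ⋆[ContinuousLinearMap.lsmul ℝ ℝ, μ] g) =
      ρ ⋆[ContinuousLinearMap.lsmul ℝ ℝ, μ] fderiv ℝ g := by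
  ext1 x
  have h := (hgc.hasFDerivAt_convolution_right (ContinuousLinearMap.lsmul ℝ ℝ) hρ hg x).fderiv
  rw [h]
  unfold convolution
  congr 1

set_option maxSynthPendingDepth 3 in
/-- A compactly supported `C²` function is a uniform limit, together with its first two
derivatives, of smooth functions. -/
lemma exists_contDiff_iteratedFDeriv_sub_le [FiniteDimensional ℝ E] {w : E → ℝ}
    (hw : ContDiff ℝ 2 w) (hwc : HasCompactSupport w) {δ : ℝ} (hδ : 0 < δ) :
    ∃ g : E → ℝ, ContDiff ℝ (⊤ : ℕ∞) g ∧
      ∀ x, ∀ j ≤ 2, ‖iteratedFDeriv ℝ j (fun y => g y - w y) x‖ ≤ δ := by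
  have h1 : ContDiff ℝ 1 (fderiv ℝ w) := hw.fderiv_right (by norm_num)
  have h2 : Continuous (fderiv ℝ (fderiv ℝ w)) := h1.continuous_fderiv one_ne_zero
  have hc1 : HasCompactSupport (fderiv ℝ w) := hwc.fderiv ℝ
  have hc2 : HasCompactSupport (fderiv ℝ (fderiv ℝ w)) := hc1.fderiv ℝ
  have u0 := Metric.uniformContinuous_iff.1 (hwc.uniformContinuous_of_continuous hw.continuous) δ hδ
  have u1 := Metric.uniformContinuous_iff.1 (hc1.uniformContinuous_of_continuous h1.continuous) δ hδ
  have u2 := (Metric.uniformContinuous_iff (β := E →L[ℝ] E →L[ℝ] ℝ)).1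
    (hc2.uniformContinuous_of_continuous h2) δ hδ
  obtain ⟨r0, hr0, u0⟩ := u0
  obtain ⟨r1, hr1, u1⟩ := u1
  obtain ⟨r2, hr2, u2⟩ := u2
  set r := min r0 (min r1 r2) with hr
  have hrpos : 0 < r := by positivity
  have hrle : r ≤ r0 ∧ r ≤ r1 ∧ r ≤ r2 := ⟨by simp [hr], by simp [hr], by simp [hr]⟩
  let μ : Measure E := Measure.addHaar
  let b : ContDiffBump (0 : E) := ⟨r / 2, r, by linarith, by linarith⟩
  have hbi : LocallyIntegrable (b.normed μ) μ := b.continuous_normed.locallyIntegrable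
  set g := b.normed μ ⋆[ContinuousLinearMap.lsmul ℝ ℝ, μ] w with hg
  have hgs : ContDiff ℝ (⊤ : ℕ∞) g :=
    b.hasCompactSupport_normed.contDiff_convolution_left _ b.contDiff_normed
      hw.continuous.locallyIntegrable
  have hg1 : fderiv ℝ g = b.normed μ ⋆[ContinuousLinearMap.lsmul ℝ ℝ, μ] fderiv ℝ w :=
    fderiv_convolution_lsmul hbi (hw.of_le (by norm_num)) hwc
  have hg2 : fderiv ℝ (fderiv ℝ g) =
      b.normed μ ⋆[ContinuousLinearMap.lsmul ℝ ℝ, μ] fderiv ℝ (fderiv ℝ w) := by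
    rw [hg1]
    exact fderiv_convolution_lsmul hbi h1 hc1
  have hgd : Differentiable ℝ g := hgs.differentiable (by simp)
  have hgd1 : Differentiable ℝ (fderiv ℝ g) :=
    ((contDiff_infty.1 hgs 2).fderiv_right
      (m := 1) (by norm_num)).differentiable (by simp)
  have hs1 : fderiv ℝ (fun y => g y - w y) = fun y => fderiv ℝ g y - fderiv ℝ w y := by
    ext1 y
    exact fderiv_fun_sub (hgd y) (hw.differentiable (by simp) y)
  refine ⟨g, hgs, fun x j hj => ?_⟩
  interval_cases j
  · rw [norm_iteratedFDeriv_zero, ← dist_eq_norm]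
    exact b.dist_normed_convolution_le hw.continuous.aestronglyMeasurable
      fun y hy => (u0 (lt_of_lt_of_le hy hrle.1)).le
  · rw [← zero_add 1, ← norm_iteratedFDeriv_fderiv, norm_iteratedFDeriv_zero, hs1, hg1,
      ← dist_eq_norm]
    exact b.dist_normed_convolution_le h1.continuous.aestronglyMeasurable
      fun y hy => (u1 (lt_of_lt_of_le hy hrle.2.1)).le
  · rw [norm_iteratedFDeriv_two_eq, hs1, fderiv_fun_sub (hgd1 x) (h1.differentiable (by simp) x),
      hg2, ← dist_eq_norm]
    exact b.dist_normed_convolution_le h2.aestronglyMeasurable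
      fun y hy => (u2 (lt_of_lt_of_le hy hrle.2.2)).le

end Approximation

section Density

variable {n : ℕ} {f g : EuclideanSpace ℝ (Fin n) → ℝ} {x : EuclideanSpace ℝ (Fin n)}

lemma abs_lap_le : |lap f x| ≤ n * ‖iteratedFDeriv ℝ 2 f x‖ := by
  calc |lap f x| ≤ ∑ i : Fin n, |iteratedFDeriv ℝ 2 f x
        ![EuclideanSpace.single i 1, EuclideanSpace.single i 1]| := Finset.abs_sum_le_sum_abs _ _
    _ ≤ ∑ _i : Fin n, ‖iteratedFDeriv ℝ 2 f x‖ := Finset.sum_le_sum fun i _ => by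
        simpa using (iteratedFDeriv ℝ 2 f x).le_opNorm
          ![EuclideanSpace.single i 1, EuclideanSpace.single i 1]
    _ = n * ‖iteratedFDeriv ℝ 2 f x‖ := by simp

lemma lap_sub (hf : ContDiff ℝ 2 f) (hg : ContDiff ℝ 2 g) :
    lap (fun y => f y - g y) x = lap f x - lap g x := by
  simp [lap, fun_iteratedFDeriv_sub_apply (i := 2) (x := x) hf.contDiffAt hg.contDiffAt]

lemma exists_norm_iteratedFDeriv_le_of_isCompact {E F : Type*} [NormedAddCommGroup E]
    [NormedSpace ℝ E] [NormedAddCommGroup F] [NormedSpace ℝ F] {h : E → F} {k : ℕ}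
    (hh : ContDiff ℝ k h) {K : Set E} (hK : IsCompact K) :
    ∃ A, 1 ≤ A ∧ ∀ x ∈ K, ∀ j ≤ k, ‖iteratedFDeriv ℝ j h x‖ ≤ A := by
  have key : ∀ j ≤ k, ∃ A, ∀ x ∈ K, ‖iteratedFDeriv ℝ j h x‖ ≤ A := fun j hj =>
    hK.exists_bound_of_continuousOn
      (hh.continuous_iteratedFDeriv (m := j) (by exact_mod_cast hj)).continuousOn
  choose! A hA using key
  refine ⟨1 + ∑ j ∈ Finset.range (k + 1), |A j|, by
    have : 0 ≤ ∑ j ∈ Finset.range (k + 1), |A j| := Finset.sum_nonneg fun _ _ => abs_nonneg _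
    linarith, fun x hx j hj => ?_⟩
  have h1 : |A j| ≤ ∑ j ∈ Finset.range (k + 1), |A j| :=
    Finset.single_le_sum (f := fun j => |A j|) (fun _ _ => abs_nonneg _)
      (Finset.mem_range.2 (by omega))
  linarith [hA j hj x hx, le_abs_self (A j)]

lemma exists_abs_sub_mul_comp_le {χ : EuclideanSpace ℝ (Fin n) → ℝ}
    {P : EuclideanSpace ℝ (Fin n) → EuclideanSpace ℝ (Fin n)}
    (hχ : ContDiff ℝ (⊤ : ℕ∞) χ) (hP : ContDiff ℝ (⊤ : ℕ∞) P)
    {K : Set (EuclideanSpace ℝ (Fin n))} (hK : IsCompact K) :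
    ∃ B, 0 < B ∧ ∀ e : EuclideanSpace ℝ (Fin n) → ℝ, ContDiff ℝ 2 e → ∀ δ, 0 ≤ δ →
      (∀ x, ∀ j ≤ 2, ‖iteratedFDeriv ℝ j e x‖ ≤ δ) → ∀ x ∈ K,
        |e x - χ x * e (P x)| ≤ B * δ ∧ |lap (fun y => e y - χ y * e (P y)) x| ≤ B * δ := by
  obtain ⟨A, hA1, hA⟩ := exists_norm_iteratedFDeriv_le_of_isCompact (contDiff_infty.1 hχ 2) hK
  obtain ⟨D, hD1, hD⟩ := exists_norm_iteratedFDeriv_le_of_isCompact (contDiff_infty.1 hP 2) hK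
  have hχ2 : ContDiff ℝ 2 χ := contDiff_infty.1 hχ 2
  have hP2 : ContDiff ℝ 2 P := contDiff_infty.1 hP 2
  refine ⟨(n + 1) * (1 + A * (8 * D ^ 2)), by positivity, fun e he δ hδ hbd x hx => ?_⟩
  have hcomp : ContDiff ℝ 2 (fun y => e (P y)) := he.comp hP2
  have hle : ∀ j ≤ 2, ‖iteratedFDeriv ℝ j (fun y => e (P y)) x‖ ≤ 2 * δ * D ^ 2 := by
    intro j hj
    have h := norm_iteratedFDeriv_comp_le (g := e) (f := P) (n := j) he hP2
      (by exact_mod_cast hj) x (C := δ) (D := D) (fun i hi => hbd _ i (hi.trans hj))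
      (fun i hi1 hi2 => (hD x hx i (hi2.trans hj)).trans (le_self_pow₀ hD1 (by omega)))
    refine h.trans ?_
    have h1 : (j.factorial : ℝ) ≤ 2 := by
      exact_mod_cast (Nat.factorial_le hj)
    have h2 : D ^ j ≤ D ^ 2 := pow_le_pow_right₀ hD1 hj
    gcongr
  have hprod : ∀ j ≤ 2, ‖iteratedFDeriv ℝ j (fun y => χ y * e (P y)) x‖ ≤ A * (8 * D ^ 2) * δ := by
    intro j hj
    refine (norm_iteratedFDeriv_mul_le (n := j) hχ2 hcomp x (by exact_mod_cast hj)).trans ?_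
    calc _ ≤ ∑ i ∈ Finset.range (j + 1), (j.choose i : ℝ) * A * (2 * δ * D ^ 2) := by
          refine Finset.sum_le_sum fun i hi => ?_
          have hi' : i ≤ j := by simpa [Nat.lt_succ_iff] using hi
          gcongr
          · exact hA x hx i (hi'.trans hj)
          · exact hle _ (by omega)
      _ = 2 ^ j * (A * (2 * δ * D ^ 2)) := by
          simp_rw [mul_assoc]
          rw [← Finset.sum_mul]
          congr 1
          exact_mod_cast Nat.sum_range_choose j
      _ ≤ 2 ^ 2 * (A * (2 * δ * D ^ 2)) := by
          gcongr
          norm_num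
      _ = _ := by ring
  constructor
  · have h0 := hbd x 0 (by norm_num)
    have h1 := hprod 0 (by norm_num)
    rw [norm_iteratedFDeriv_zero, Real.norm_eq_abs] at h0 h1
    have h2 := abs_sub (e x) (χ x * e (P x))
    have h3 : (1 + A * (8 * D ^ 2)) * δ ≤ (n + 1) * (1 + A * (8 * D ^ 2)) * δ := by
      have : (0:ℝ) ≤ n * ((1 + A * (8 * D ^ 2)) * δ) := by positivity
      linarith
    linarith
  · refine abs_lap_le.trans ?_
    have h : ‖iteratedFDeriv ℝ 2 (fun y => e y - χ y * e (P y)) x‖ ≤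
        δ + A * (8 * D ^ 2) * δ := by
      rw [fun_iteratedFDeriv_sub_apply (i := 2) he.contDiffAt
        ((hχ2.mul hcomp).contDiffAt)]
      exact (norm_sub_le _ _).trans (add_le_add (hbd x 2 le_rfl) (hprod 2 le_rfl))
    have h3 : (0:ℝ) ≤ (1 + A * (8 * D ^ 2)) * δ := by positivity
    nlinarith [mul_le_mul_of_nonneg_left h (Nat.cast_nonneg (α := ℝ) n)]

/-- On a smooth bounded convex domain, `C²` functions vanishing on the boundary are limits of
smooth functions vanishing on the boundary, uniformly together with their Laplacians. -/
lemma exists_contDiff_approx_of_eq_zero_frontier {Ω : Set (EuclideanSpace ℝ (Fin n))}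
    (ho : IsOpen Ω) (hb : Bornology.IsBounded Ω) (hc : Convex ℝ Ω)
    (hsmooth : ∃ f : EuclideanSpace ℝ (Fin n) → ℝ, ContDiff ℝ (⊤ : ℕ∞) f ∧
      Ω = f ⁻¹' Set.Iio 0 ∧ frontier Ω = f ⁻¹' {0} ∧
      ∀ x ∈ frontier Ω, gradient f x ≠ 0) (hne : Ω.Nonempty)
    {w : EuclideanSpace ℝ (Fin n) → ℝ} (hw : ContDiff ℝ 2 w) (hw0 : ∀ x ∈ frontier Ω, w x = 0)
    {ε : ℝ} (hε : 0 < ε) :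
    ∃ φ : EuclideanSpace ℝ (Fin n) → ℝ, ContDiff ℝ (⊤ : ℕ∞) φ ∧ (∀ x ∈ frontier Ω, φ x = 0) ∧
      ∀ x ∈ closure Ω, |φ x - w x| ≤ ε ∧ |lap φ x - lap w x| ≤ ε := by
  obtain ⟨χ, P, hχ, hP, hχP, hPfr⟩ := exists_smooth_retraction ho hb hc hsmooth hne
  obtain ⟨B, hB, hest⟩ := exists_abs_sub_mul_comp_le hχ hP hb.isCompact_closure
  obtain ⟨R, hR, hsub⟩ := hb.closure.subset_ball_lt 0 0
  let ζ : ContDiffBump (0 : EuclideanSpace ℝ (Fin n)) := ⟨R, R + 1, hR, by linarith⟩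
  have hζw : ContDiff ℝ 2 (fun y => ζ y * w y) := ζ.contDiff.mul hw
  obtain ⟨g, hg, hgw⟩ := exists_contDiff_iteratedFDeriv_sub_le hζw ζ.hasCompactSupport.mul_right
    (div_pos hε hB)
  have hg2 : ContDiff ℝ 2 g := contDiff_infty.1 hg 2
  have hφ : ContDiff ℝ (⊤ : ℕ∞) (fun y => g y - χ y * g (P y)) := hg.sub (hχ.mul (hg.comp hP))
  refine ⟨fun y => g y - χ y * g (P y), hφ, fun x hx => ?_, fun x hx => ?_⟩
  · simp [hχP x hx]
  · have h := hest (fun y => g y - ζ y * w y) (hg2.sub hζw) _ (div_pos hε hB).le hgw x hx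
    have heq : (fun y => g y - ζ y * w y - χ y * (g (P y) - ζ (P y) * w (P y))) =
        fun y => (g y - χ y * g (P y)) - ζ y * w y := by
      ext y
      by_cases hy : χ y = 0
      · simp [hy]
      · rw [hw0 _ (hPfr y hy)]
        ring
    have hev : (fun y => ζ y * w y) =ᶠ[nhds x] w := by
      filter_upwards [Metric.isOpen_ball.mem_nhds (hsub hx)] with y hy
      rw [ζ.one_of_mem_closedBall (Metric.ball_subset_closedBall hy), one_mul]
    rw [mul_div_cancel₀ _ hB.ne'] at h
    have h1 := h.1
    have h2 := h.2
    rw [show (g x - ζ x * w x - χ x * (g (P x) - ζ (P x) * w (P x))) = _ from congrFun heq x,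
      hev.eq_of_nhds] at h1
    rw [heq, lap_sub (contDiff_infty.1 hφ 2) hζw, hev.lap_eq] at h2
    exact ⟨h1, h2⟩

lemma tendsto_setIntegral_mul_sq {Ω : Set (EuclideanSpace ℝ (Fin n))} (ho : IsOpen Ω)
    (hb : Bornology.IsBounded Ω) {c f : EuclideanSpace ℝ (Fin n) → ℝ}
    {F : ℕ → EuclideanSpace ℝ (Fin n) → ℝ} (hc : Continuous c) (hf : Continuous f)
    (hF : ∀ k, Continuous (F k)) (hFf : ∀ k : ℕ, ∀ x ∈ closure Ω, |F k x - f x| ≤ 1 / (k + 1)) :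
    Filter.Tendsto (fun k => ∫ x in Ω, c x * F k x ^ 2) Filter.atTop
      (nhds (∫ x in Ω, c x * f x ^ 2)) := by
  obtain ⟨A, hA⟩ := hb.isCompact_closure.exists_bound_of_continuousOn hc.continuousOn
  obtain ⟨M, hM⟩ := hb.isCompact_closure.exists_bound_of_continuousOn hf.continuousOn
  refine tendsto_integral_of_dominated_convergence (fun _ => A * (M + 1) ^ 2)
    (fun k => (hc.mul ((hF k).pow 2)).aestronglyMeasurable) ?_ (fun k => ?_) ?_
  · have := hb.measure_lt_top (μ := volume)
    exact integrableOn_const this.ne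
  · refine (ae_restrict_iff' ho.measurableSet).2 (Filter.Eventually.of_forall fun x hx => ?_)
    have h1 := hA x (subset_closure hx)
    have h2 := hM x (subset_closure hx)
    have h3 := hFf k x (subset_closure hx)
    have h4 : (1:ℝ) / (k + 1) ≤ 1 := by
      rw [div_le_one (by positivity)]
      linarith [Nat.cast_nonneg (α := ℝ) k]
    rw [Real.norm_eq_abs] at h2
    have h5 : |F k x| ≤ M + 1 := by
      have := abs_add_le (F k x - f x) (f x)
      rw [sub_add_cancel] at this
      linarith
    rw [norm_mul, norm_pow]
    have h6 : 0 ≤ A := (norm_nonneg _).trans h1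
    rw [← Real.norm_eq_abs] at h5
    gcongr
  · refine (ae_restrict_iff' ho.measurableSet).2 (Filter.Eventually.of_forall fun x hx => ?_)
    have h : Filter.Tendsto (fun k => F k x) Filter.atTop (nhds (f x)) := by
      rw [tendsto_iff_dist_tendsto_zero]
      exact squeeze_zero (fun _ => dist_nonneg)
        (fun k => by rw [Real.dist_eq]; exact hFf k x (subset_closure hx))
        tendsto_one_div_add_atTop_nhds_zero_nat
    exact (h.pow 2).const_mul _

/-- The stability inequality extends to `C²` test functions vanishing on the boundary. -/
lemma IsStableSol.le_setIntegral_lap_sq {Ω : Set (EuclideanSpace ℝ (Fin n))}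
    (ho : IsOpen Ω) (hb : Bornology.IsBounded Ω) (hc : Convex ℝ Ω)
    (hsmooth : ∃ f : EuclideanSpace ℝ (Fin n) → ℝ, ContDiff ℝ (⊤ : ℕ∞) f ∧
      Ω = f ⁻¹' Set.Iio 0 ∧ frontier Ω = f ⁻¹' {0} ∧
      ∀ x ∈ frontier Ω, gradient f x ≠ 0) (hne : Ω.Nonempty) {p lam : ℝ} (hp : 1 < p)
    {u : EuclideanSpace ℝ (Fin n) → ℝ} (hu : IsStableSol Ω p lam u)
    {w : EuclideanSpace ℝ (Fin n) → ℝ} (hw : ContDiff ℝ 2 w) (hw0 : ∀ x ∈ frontier Ω, w x = 0) :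
    lam * p * ∫ x in Ω, (u x + 1) ^ (p - 1) * w x ^ 2 ≤ ∫ x in Ω, (lap w x) ^ 2 := by
  obtain ⟨hu4, -, -, -, hstab⟩ := hu
  have key : ∀ k : ℕ, ∃ φ : EuclideanSpace ℝ (Fin n) → ℝ, ContDiff ℝ (⊤ : ℕ∞) φ ∧
      (∀ x ∈ frontier Ω, φ x = 0) ∧
      ∀ x ∈ closure Ω, |φ x - w x| ≤ 1 / (k + 1) ∧ |lap φ x - lap w x| ≤ 1 / (k + 1) := fun k =>
    exists_contDiff_approx_of_eq_zero_frontier ho hb hc hsmooth hne hw hw0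
      Nat.one_div_pos_of_nat
  choose φ hφ hφ0 hφw using key
  have hcu : Continuous fun x => (u x + 1) ^ (p - 1) :=
    (hu4.continuous.add continuous_const).rpow_const fun x => Or.inr (by linarith)
  have h1 := tendsto_setIntegral_mul_sq ho hb hcu hw.continuous (fun k => (hφ k).continuous)
    fun k x hx => (hφw k x hx).1
  have h2 := tendsto_setIntegral_mul_sq ho hb (c := fun _ => 1) continuous_const
    (hw.lap (k := 0) (by norm_num)).continuous
    (fun k => ((contDiff_infty.1 (hφ k) 2).lap (k := 0) (by norm_num)).continuous)
    fun k x hx => (hφw k x hx).2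
  simp only [one_mul] at h2
  exact le_of_tendsto_of_tendsto' (h1.const_mul _) h2 fun k => hstab _ (hφ k) (hφ0 k)

end Density

section Divergence

variable {n : ℕ} {v : EuclideanSpace ℝ (Fin n) → ℝ}

lemma sum_pderiv_mul {c : EuclideanSpace ℝ (Fin n) → ℝ}
    {X : Fin n → EuclideanSpace ℝ (Fin n) → ℝ} {x : EuclideanSpace ℝ (Fin n)}
    (hc : DifferentiableAt ℝ c x) (hX : ∀ i, DifferentiableAt ℝ (X i) x) :
    ∑ i, pderiv i (fun y => c y * X i y) x =
      ∑ i, pderiv i c x * X i x + c x * ∑ i, pderiv i (X i) x := by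
  simp_rw [pderiv_mul hc (hX _), Finset.sum_add_distrib, Finset.mul_sum]

lemma ContDiff.rpow_const_of_pos {m : WithTop ℕ∞} (hv : ContDiff ℝ m v) (hpos : ∀ x, 0 < v x)
    (s : ℝ) : ContDiff ℝ m (fun x => v x ^ s) :=
  hv.rpow_const_of_ne fun x => (hpos x).ne'

lemma sum_pderiv_rpow_mul (hv : ContDiff ℝ 1 v) (hpos : ∀ x, 0 < v x) (s : ℝ)
    {X : Fin n → EuclideanSpace ℝ (Fin n) → ℝ} (hX : ∀ i, ContDiff ℝ 1 (X i))
    (x : EuclideanSpace ℝ (Fin n)) :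
    ∑ i, pderiv i (fun y => v y ^ s * X i y) x =
      s * v x ^ (s - 1) * ∑ i, pderiv i v x * X i x + v x ^ s * ∑ i, pderiv i (X i) x := by
  have hd : DifferentiableAt ℝ v x := hv.differentiable (by simp) x
  rw [sum_pderiv_mul (hd.rpow_const (Or.inl (hpos x).ne'))
    (fun i => (hX i).differentiable (by simp) x)]
  simp_rw [pderiv_rpow hd (hpos x).ne', Finset.mul_sum, mul_assoc]

lemma sum_pderiv_rpow_mul_pderiv (hv : ContDiff ℝ 2 v) (hpos : ∀ x, 0 < v x) (s : ℝ)
    (x : EuclideanSpace ℝ (Fin n)) :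
    ∑ i, pderiv i (fun y => v y ^ s * pderiv i v y) x =
      s * v x ^ (s - 1) * ∑ i, pderiv i v x ^ 2 + v x ^ s * lap v x := by
  rw [sum_pderiv_rpow_mul (hv.of_le (by norm_num)) hpos s (fun i => hv.pderiv (by norm_num) i),
    lap_eq_sum_pderiv hv]
  simp_rw [sq]

lemma lap_rpow (hv : ContDiff ℝ 2 v) (hpos : ∀ x, 0 < v x) (s : ℝ)
    (x : EuclideanSpace ℝ (Fin n)) :
    lap (fun y => v y ^ s) x =
      s * v x ^ (s - 1) * lap v x + s * (s - 1) * v x ^ (s - 2) * ∑ i, pderiv i v x ^ 2 := by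
  have h : ∀ i, pderiv i (fun y => v y ^ s) = fun y => s * (v y ^ (s - 1) * pderiv i v y) := by
    intro i
    ext y
    rw [pderiv_rpow (hv.differentiable (by simp) y) (hpos y).ne', mul_assoc]
  rw [lap_eq_sum_pderiv (hv.rpow_const_of_pos hpos s)]
  simp_rw [h]
  have hd : ∀ i, DifferentiableAt ℝ (fun y => v y ^ (s - 1) * pderiv i v y) x := fun i =>
    (((hv.of_le (by norm_num)).rpow_const_of_pos hpos (s - 1)).mul
      (hv.pderiv (k := 1) (by norm_num) i)).differentiable (by simp) x
  simp_rw [pderiv_const_mul (hd _), ← Finset.mul_sum]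
  rw [sum_pderiv_rpow_mul_pderiv hv hpos, show s - 1 - 1 = s - 2 by ring]
  ring

lemma sum_pderiv_rpow_mul_pderiv_lap (hv : ContDiff ℝ 4 v) (hpos : ∀ x, 0 < v x) (q : ℝ)
    (x : EuclideanSpace ℝ (Fin n)) :
    ∑ i, pderiv i (fun y => v y ^ q * pderiv i (lap v) y
        - q * (v y ^ (q - 1) * (lap v y * pderiv i v y))) x =
      v x ^ q * lap (lap v) x - q * (v x ^ (q - 1) * lap v x ^ 2
        + (q - 1) * v x ^ (q - 2) * lap v x * ∑ i, pderiv i v x ^ 2) := by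
  have hv1 : ContDiff ℝ 1 v := hv.of_le (by norm_num)
  have hv2 : ContDiff ℝ 2 v := hv.of_le (by norm_num)
  have hL : ContDiff ℝ 2 (lap v) := hv.lap (by norm_num)
  have hL1 : ContDiff ℝ 1 (lap v) := hL.of_le (by norm_num)
  have hLi : ∀ i, ContDiff ℝ 1 (pderiv i (lap v)) := fun i => hL.pderiv (by norm_num) i
  have hvi : ∀ i, ContDiff ℝ 1 (pderiv i v) := fun i => hv.pderiv (by norm_num) i
  have hX : ∀ i, ContDiff ℝ 1 (fun y => lap v y * pderiv i v y) := fun i => hL1.mul (hvi i)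
  have hA : ∀ i, DifferentiableAt ℝ (fun y => v y ^ q * pderiv i (lap v) y) x := fun i =>
    ((hv1.rpow_const_of_pos hpos q).mul (hLi i)).differentiable (by simp) x
  have hB : ∀ i, DifferentiableAt ℝ (fun y => v y ^ (q - 1) * (lap v y * pderiv i v y)) x :=
    fun i => ((hv1.rpow_const_of_pos hpos (q - 1)).mul (hX i)).differentiable (by simp) x
  simp_rw [pderiv_sub (hA _) ((hB _).const_mul q), pderiv_const_mul (hB _), Finset.sum_sub_distrib,
    ← Finset.mul_sum]
  rw [sum_pderiv_rpow_mul hv1 hpos q hLi, sum_pderiv_rpow_mul hv1 hpos (q - 1) hX,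
    sum_pderiv_mul (hL1.differentiable (by simp) x) (fun i => (hvi i).differentiable (by simp) x)]
  have e1 : ∑ i, pderiv i (pderiv i (lap v)) x = lap (lap v) x := by rw [lap_eq_sum_pderiv hL]
  have e2 : ∑ i, pderiv i (pderiv i v) x = lap v x := by rw [lap_eq_sum_pderiv hv2]
  have e3 : ∑ i, pderiv i v x * (lap v x * pderiv i v x) = lap v x * ∑ i, pderiv i v x ^ 2 := by
    rw [Finset.mul_sum]
    exact Finset.sum_congr rfl fun i _ => by ring
  have e4 : ∑ i, pderiv i (lap v) x * pderiv i v x = ∑ i, pderiv i v x * pderiv i (lap v) x :=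
    Finset.sum_congr rfl fun i _ => by ring
  rw [e1, e2, e3, e4, show q - 1 - 1 = q - 2 by ring]
  ring

lemma sum_pderiv_pderiv_pderiv (hv : ContDiff ℝ 3 v) (j : Fin n)
    (x : EuclideanSpace ℝ (Fin n)) :
    ∑ i, pderiv i (pderiv i (pderiv j v)) x = pderiv j (lap v) x := by
  have hv2 : ContDiff ℝ 2 v := hv.of_le (by norm_num)
  rw [lap_eq_sum_pderiv hv2, pderiv_sum fun i _ =>
    ((hv.pderiv (k := 2) (by norm_num) i).pderiv (k := 1) (by norm_num) i).differentiable
      (by simp) x]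
  refine Finset.sum_congr rfl fun i _ => ?_
  rw [pderiv_comm hv2 i j, pderiv_comm (hv.pderiv (by norm_num) i) i j]

lemma sum_pderiv_rpow_mul_hessian (hv : ContDiff ℝ 4 v) (hpos : ∀ x, 0 < v x) (s : ℝ)
    (x : EuclideanSpace ℝ (Fin n)) :
    ∑ i, pderiv i (fun y => v y ^ s * (lap v y * pderiv i v y
        - ∑ j, pderiv i (pderiv j v) y * pderiv j v y)) x =
      s * v x ^ (s - 1) * (lap v x * ∑ i, pderiv i v x ^ 2
        - ∑ i, ∑ j, pderiv i v x * pderiv j v x * pderiv i (pderiv j v) x)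
      + v x ^ s * (lap v x ^ 2 - ∑ i, ∑ j, pderiv i (pderiv j v) x ^ 2) := by
  have hv1 : ContDiff ℝ 1 v := hv.of_le (by norm_num)
  have hv2 : ContDiff ℝ 2 v := hv.of_le (by norm_num)
  have hL1 : ContDiff ℝ 1 (lap v) := hv.lap (by norm_num)
  have hvi : ∀ i, ContDiff ℝ 1 (pderiv i v) := fun i => hv.pderiv (by norm_num) i
  have hvij : ∀ i j, ContDiff ℝ 1 (pderiv i (pderiv j v)) := fun i j =>
    (hv.pderiv (k := 2) (by norm_num) j).pderiv (by norm_num) i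
  have hX : ∀ i, ContDiff ℝ 1 (fun y => lap v y * pderiv i v y) := fun i => hL1.mul (hvi i)
  have hY : ∀ i, ContDiff ℝ 1 (fun y => ∑ j, pderiv i (pderiv j v) y * pderiv j v y) := fun i =>
    ContDiff.sum fun j _ => (hvij i j).mul (hvi j)
  have dv : ∀ i, DifferentiableAt ℝ (pderiv i v) x := fun i => (hvi i).differentiable (by simp) x
  rw [sum_pderiv_rpow_mul hv1 hpos s (fun i => (hX i).sub (hY i))]
  simp_rw [pderiv_sub ((hX _).differentiable (by simp) x) ((hY _).differentiable (by simp) x)]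
  rw [Finset.sum_sub_distrib, sum_pderiv_mul (hL1.differentiable (by simp) x) dv]
  have e1 : ∑ i, pderiv i (fun y => ∑ j, pderiv i (pderiv j v) y * pderiv j v y) x =
      ∑ j, pderiv j (lap v) x * pderiv j v x + ∑ i, ∑ j, pderiv i (pderiv j v) x ^ 2 := by
    have : ∀ i, pderiv i (fun y => ∑ j, pderiv i (pderiv j v) y * pderiv j v y) x =
        ∑ j, (pderiv i (pderiv i (pderiv j v)) x * pderiv j v x
          + pderiv i (pderiv j v) x ^ 2) := by
      intro i
      rw [pderiv_sum fun j _ => ((hvij i j).mul (hvi j)).differentiable (by simp) x]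
      refine Finset.sum_congr rfl fun j _ => ?_
      rw [pderiv_mul ((hvij i j).differentiable (by simp) x) (dv j), sq]
    simp_rw [this, Finset.sum_add_distrib]
    rw [Finset.sum_comm]
    simp_rw [← Finset.sum_mul, sum_pderiv_pderiv_pderiv (hv.of_le (by norm_num))]
  have e2 : ∑ i, pderiv i (pderiv i v) x = lap v x := by rw [lap_eq_sum_pderiv hv2]
  have e3 : ∑ i, pderiv i v x * (lap v x * pderiv i v x
      - ∑ j, pderiv i (pderiv j v) x * pderiv j v x) = lap v x * ∑ i, pderiv i v x ^ 2
        - ∑ i, ∑ j, pderiv i v x * pderiv j v x * pderiv i (pderiv j v) x := by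
    rw [Finset.mul_sum, ← Finset.sum_sub_distrib]
    refine Finset.sum_congr rfl fun i _ => ?_
    rw [mul_sub, Finset.mul_sum]
    congr 1
    · ring
    · exact Finset.sum_congr rfl fun j _ => by ring
  rw [e1, e2, e3]
  ring

lemma pderiv_sum_pderiv_sq (hv : ContDiff ℝ 2 v) (i : Fin n) (x : EuclideanSpace ℝ (Fin n)) :
    pderiv i (fun y => ∑ j, pderiv j v y ^ 2) x =
      ∑ j, 2 * (pderiv j v x * pderiv i (pderiv j v) x) := by
  have dv : ∀ j, DifferentiableAt ℝ (pderiv j v) x := fun j =>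
    (hv.pderiv (k := 1) (by norm_num) j).differentiable (by simp) x
  simp_rw [sq]
  rw [pderiv_sum (F := fun j y => pderiv j v y * pderiv j v y) fun j _ => (dv j).mul (dv j)]
  refine Finset.sum_congr rfl fun j _ => ?_
  rw [pderiv_mul (dv j) (dv j)]
  ring

lemma sum_pderiv_rpow_mul_gradient_sq (hv : ContDiff ℝ 2 v) (hpos : ∀ x, 0 < v x) (t : ℝ)
    (x : EuclideanSpace ℝ (Fin n)) :
    ∑ i, pderiv i (fun y => v y ^ t * ((∑ j, pderiv j v y ^ 2) * pderiv i v y)) x =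
      t * v x ^ (t - 1) * (∑ i, pderiv i v x ^ 2) ^ 2 + v x ^ t *
        (2 * ∑ i, ∑ j, pderiv i v x * pderiv j v x * pderiv i (pderiv j v) x
          + (∑ i, pderiv i v x ^ 2) * lap v x) := by
  have hvi : ∀ i, ContDiff ℝ 1 (pderiv i v) := fun i => hv.pderiv (by norm_num) i
  have hG : ContDiff ℝ 1 (fun y => ∑ j, pderiv j v y ^ 2) := ContDiff.sum fun j _ => (hvi j).pow 2
  rw [sum_pderiv_rpow_mul (hv.of_le (by norm_num)) hpos t (fun i => hG.mul (hvi i)),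
    sum_pderiv_mul (hG.differentiable (by simp) x) (fun i => (hvi i).differentiable (by simp) x)]
  have e2 : ∑ i, pderiv i (pderiv i v) x = lap v x := by rw [lap_eq_sum_pderiv hv]
  have e3 : ∑ i, pderiv i (fun y => ∑ j, pderiv j v y ^ 2) x * pderiv i v x =
      2 * ∑ i, ∑ j, pderiv i v x * pderiv j v x * pderiv i (pderiv j v) x := by
    rw [Finset.mul_sum]
    refine Finset.sum_congr rfl fun i _ => ?_
    rw [pderiv_sum_pderiv_sq hv, Finset.sum_mul, Finset.mul_sum]
    exact Finset.sum_congr rfl fun j _ => by ring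
  have e4 : ∑ i, pderiv i v x * ((∑ j, pderiv j v x ^ 2) * pderiv i v x) =
      (∑ i, pderiv i v x ^ 2) ^ 2 := by
    rw [sq (∑ i, pderiv i v x ^ 2), Finset.mul_sum]
    exact Finset.sum_congr rfl fun i _ => by ring
  rw [e2, e3, e4]

lemma sq_sum_sum_mul_pderiv_pderiv_le (x : EuclideanSpace ℝ (Fin n)) :
    (∑ i, ∑ j, pderiv i v x * pderiv j v x * pderiv i (pderiv j v) x) ^ 2 ≤
      (∑ i, pderiv i v x ^ 2) ^ 2 * ∑ i, ∑ j, pderiv i (pderiv j v) x ^ 2 := by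
  have h := Finset.sum_mul_sq_le_sq_mul_sq (Finset.univ : Finset (Fin n × Fin n))
    (fun a => pderiv a.1 v x * pderiv a.2 v x) (fun a => pderiv a.1 (pderiv a.2 v) x)
  simp only [Fintype.sum_prod_type] at h
  refine h.trans_eq ?_
  congr 1
  rw [sq (∑ i, pderiv i v x ^ 2), Finset.sum_mul_sum]
  simp_rw [mul_pow]

end Divergence

section MaximumPrinciple

variable {n : ℕ} {f v : EuclideanSpace ℝ (Fin n) → ℝ}

lemma deriv_line (hf : Differentiable ℝ f) (i : Fin n) (x : EuclideanSpace ℝ (Fin n)) :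
    deriv (fun t : ℝ => f (x + t • EuclideanSpace.single i 1)) =
      fun t => pderiv i f (x + t • EuclideanSpace.single i 1) := by
  ext t
  have h : HasDerivAt (fun t : ℝ => x + t • EuclideanSpace.single i (1 : ℝ))
      (EuclideanSpace.single i 1) t := by
    simpa using ((hasDerivAt_id t).smul_const (EuclideanSpace.single i (1 : ℝ))).const_add x
  exact ((hf _).hasFDerivAt.comp_hasDerivAt t h).deriv

lemma IsLocalMax.pderiv_pderiv_nonpos {x : EuclideanSpace ℝ (Fin n)} (hx : IsLocalMax f x)
    (hf : ContDiff ℝ 2 f) (i : Fin n) : pderiv i (pderiv i f) x ≤ 0 := by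
  by_contra! hpos
  set φ : ℝ → ℝ := fun t => f (x + t • EuclideanSpace.single i 1) with hφ
  have hcont : Continuous fun t : ℝ => x + t • EuclideanSpace.single i (1 : ℝ) := by fun_prop
  have hd1 : deriv φ = fun t => pderiv i f (x + t • EuclideanSpace.single i 1) :=
    deriv_line (hf.differentiable (by simp)) i x
  have hd2 : deriv (deriv φ) 0 = pderiv i (pderiv i f) x := by
    rw [hd1, deriv_line ((hf.pderiv (k := 1) (by norm_num) i).differentiable (by simp)) i x]
    simp
  have hmax : IsLocalMax φ 0 := by
    have h : Filter.Tendsto (fun t : ℝ => x + t • EuclideanSpace.single i (1 : ℝ)) (nhds 0)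
        (nhds x) := by simpa using hcont.tendsto 0
    filter_upwards [h.eventually hx] with t ht
    simpa [hφ] using ht
  have hmin : IsLocalMin φ 0 := isLocalMin_of_deriv_deriv_pos (by rwa [hd2]) hmax.deriv_eq_zero
    (hf.continuous.comp hcont).continuousAt
  have hconst : φ =ᶠ[nhds 0] fun _ => φ 0 := by
    filter_upwards [hmax, hmin] with t h1 h2 using le_antisymm h1 h2
  have : deriv (deriv φ) 0 = 0 := by
    rw [hconst.deriv.deriv_eq]
    simp
  linarith

lemma IsLocalMax.lap_nonpos {x : EuclideanSpace ℝ (Fin n)} (hx : IsLocalMax f x)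
    (hf : ContDiff ℝ 2 f) : lap f x ≤ 0 := by
  rw [lap_eq_sum_pderiv hf]
  exact Finset.sum_nonpos fun i _ => hx.pderiv_pderiv_nonpos hf i

/-- The pointwise lower bound `-Δv ≥ l (v ^ α - 1)` with `α = (p + 1) / 2` and `l ^ 2 α = lam`. -/
lemma mul_rpow_sub_one_le_neg_lap {Ω : Set (EuclideanSpace ℝ (Fin n))} (ho : IsOpen Ω)
    (hb : Bornology.IsBounded Ω) (hv : ContDiff ℝ 4 v) (hpos : ∀ x, 0 < v x) {p lam α l : ℝ}
    (hα1 : 1 < α) (hα : 2 * α - 1 = p) (hl : 0 < l) (hlam : l ^ 2 * α = lam)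
    (heq : ∀ x ∈ Ω, lap (lap v) x = lam * v x ^ p)
    (hbdry : ∀ x ∈ frontier Ω, v x = 1 ∧ lap v x = 0) :
    ∀ x ∈ closure Ω, l * (v x ^ α - 1) ≤ -lap v x := by
  have hv2 : ContDiff ℝ 2 v := hv.of_le (by norm_num)
  have hL : ContDiff ℝ 2 (lap v) := hv.lap (by norm_num)
  have hva : ContDiff ℝ 2 (fun x => v x ^ α) := hv2.rpow_const_of_pos hpos α
  have hD : ContDiff ℝ 2 (fun x => l * v x ^ α - (l - lap v x)) :=
    (contDiff_const.mul hva).sub (contDiff_const.sub hL)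
  intro x hx
  obtain ⟨y, hy, hmax⟩ := hb.isCompact_closure.exists_isMaxOn ⟨x, hx⟩ hD.continuous.continuousOn
  have hxy : l * v x ^ α - (l - lap v x) ≤ l * v y ^ α - (l - lap v y) := hmax hx
  by_contra! hlt
  have hypos : 0 < l * v y ^ α - (l - lap v y) := by linarith
  have hyΩ : y ∈ Ω := by
    by_contra hyn
    have hfr : y ∈ frontier Ω := by rw [ho.frontier_eq]; exact ⟨hy, hyn⟩
    rw [(hbdry y hfr).1, (hbdry y hfr).2, one_rpow] at hypos
    linarith
  have hloc : IsLocalMax (fun x => l * v x ^ α - (l - lap v x)) y :=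
    hmax.isLocalMax (Filter.mem_of_superset (ho.mem_nhds hyΩ) subset_closure)
  have hle := hloc.lap_nonpos hD
  have hlapD : lap (fun x => l * v x ^ α - (l - lap v x)) y =
      l * lap (fun x => v x ^ α) y + lap (lap v) y := by
    rw [lap_sub (contDiff_const.mul hva) (contDiff_const.sub hL), lap_sub contDiff_const hL]
    have h1 : lap (fun x => l * v x ^ α) y = l * lap (fun x => v x ^ α) y := by
      have := iteratedFDeriv_const_smul_apply (a := l) (i := 2) (x := y) hva.contDiffAt
      simp only [lap, Finset.mul_sum]
      refine Finset.sum_congr rfl fun i _ => ?_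
      exact congrFun (congrArg DFunLike.coe this) _
    have h2 : lap (fun _ : EuclideanSpace ℝ (Fin n) => l) y = 0 := by
      simp [lap, iteratedFDeriv_const_of_ne]
    rw [h1, h2]
    ring
  rw [hlapD, lap_rpow hv2 hpos, heq y hyΩ] at hle
  have hp1 : 0 < v y ^ (α - 1) := rpow_pos_of_pos (hpos y) _
  have hp2 : 0 ≤ v y ^ (α - 2) := (rpow_pos_of_pos (hpos y) _).le
  have hG : 0 ≤ ∑ i, pderiv i v y ^ 2 := Finset.sum_nonneg fun _ _ => sq_nonneg _
  have hvp : v y ^ p = v y ^ α * v y ^ (α - 1) := by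
    rw [← rpow_add (hpos y)]
    congr 1
    linarith
  rw [hvp, ← hlam] at hle
  have hα0 : 0 < α := by linarith
  have h3 : 0 < l * (α * v y ^ (α - 1)) * (l * v y ^ α - (l - lap v y)) := by positivity
  have h4 : 0 ≤ l * (α * (α - 1) * v y ^ (α - 2) * ∑ i, pderiv i v y ^ 2) := by
    have : 0 ≤ α - 1 := by linarith
    positivity
  have h5 : 0 < l ^ 2 * α * v y ^ (α - 1) := by positivity
  nlinarith

end MaximumPrinciple

section Estimates

variable {n : ℕ}

lemma exists_pos_contDiff_eventuallyEq_add_one {E : Type*} [NormedAddCommGroup E]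
    [NormedSpace ℝ E] {m : ℕ} {u : E → ℝ} (hu : ContDiff ℝ m u) {K : Set E}
    (hK : ∀ x ∈ K, 0 ≤ u x) :
    ∃ v : E → ℝ, ContDiff ℝ m v ∧ (∀ x, 0 < v x) ∧ ∀ x ∈ K, v =ᶠ[nhds x] fun y => u y + 1 := by
  refine ⟨fun y => 1 / 4 + smoothTransition (4 * (u y + 1) - 1) * ((u y + 1) - 1 / 4), ?_,
    fun y => ?_, fun x hx => ?_⟩
  · have h1 : ContDiff ℝ m (fun y => u y + 1) := hu.add contDiff_const
    exact contDiff_const.add ((smoothTransition.contDiff.comp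
      ((contDiff_const.mul h1).sub contDiff_const)).mul (h1.sub contDiff_const))
  · rcases le_total (u y + 1) (1 / 4) with h | h
    · have : smoothTransition (4 * (u y + 1) - 1) = 0 :=
        smoothTransition.zero_of_nonpos (by linarith)
      simp [this]
    · have := mul_nonneg (smoothTransition.nonneg (4 * (u y + 1) - 1)) (sub_nonneg.2 h)
      linarith
  · have h : ∀ᶠ y in nhds x, -1 / 2 < u y :=
      (hu.continuous.tendsto x).eventually_const_lt (by linarith [hK x hx])
    filter_upwards [h] with y hy
    rw [smoothTransition.one_of_one_le (by linarith)]
    ring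

lemma exists_mul_rpow_le {r m : ℝ} (hr : 0 ≤ r) (hrm : r < m) {A δ : ℝ} (hA : 0 ≤ A)
    (hδ : 0 < δ) : ∃ C, 0 ≤ C ∧ ∀ t : ℝ, 1 ≤ t → A * t ^ r ≤ δ * t ^ m + C := by
  obtain ⟨t₀, ht₀⟩ := Filter.eventually_atTop.1
    ((tendsto_rpow_atTop (sub_pos.2 hrm)).eventually_ge_atTop (A / δ))
  refine ⟨A * |t₀| ^ r, by positivity, fun t ht => ?_⟩
  have htp : 0 < t := by linarith
  rcases le_total t₀ t with h | h
  · have h1 := ht₀ t h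
    rw [div_le_iff₀ hδ] at h1
    have h2 : t ^ m = t ^ (m - r) * t ^ r := by rw [← rpow_add htp]; ring_nf
    have h3 : 0 ≤ A * |t₀| ^ r := by positivity
    have h4 : 0 ≤ t ^ r := by positivity
    rw [h2]
    nlinarith [mul_le_mul_of_nonneg_right h1 h4]
  · have h3 : 0 ≤ δ * t ^ m := by positivity
    have h4 : t ^ r ≤ |t₀| ^ r := rpow_le_rpow htp.le (h.trans (le_abs_self _)) hr
    nlinarith [mul_le_mul_of_nonneg_left h4 hA]

lemma mul_sq_le_of_divergence_identities {W a b d N R l lam γ s β q ε : ℝ} (hW : 0 ≤ W)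
    (ha : 0 ≤ a) (hb : b ^ 2 ≤ N * a ^ 2) (hN : 0 ≤ N) (hR : 1 ≤ R) (hl : 0 < l)
    (hlR : l * (R - 1) ≤ -d) (hβ : 0 < β) (hq0 : 0 < q) (hε : 0 < ε) :
    (1 - s ^ 2 - 2 * s ^ 2 * ε) * (γ ^ 2 * W * (d + s / 2 * a) ^ 2) ≤
      γ ^ 2 / q * (lam * (W * R ^ 2))
      - γ ^ 2 * s ^ 2 / 2 * (l ^ 2 / β) * (W * R ^ 2)
      + γ ^ 2 * s ^ 2 / 2 * (l ^ 2 / β) * (W * R)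
      + γ ^ 2 * s ^ 2 / (8 * ε) * l ^ 2 * W
      - γ ^ 2 / q * (lam * (W * R ^ 2) - q * (W * (d ^ 2 + s * a * d)))
      - s ^ 2 * (1 + 2 * ε) * γ ^ 2 * (W * (s * (d * a - b) + d ^ 2 - N))
      - s ^ 2 / 2 * (1 + 2 * ε) * γ ^ 2 * (W * ((s - 1) * a ^ 2 + 2 * b + a * d))
      - s ^ 2 * γ ^ 2 / 2 * (l / β) * (R * W * (β * a + d)) := by
  have hd : d ≤ 0 := by
    have : 0 ≤ l * (R - 1) := mul_nonneg hl.le (by linarith)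
    linarith
  have hcs : 0 ≤ 4 * N - 4 * (1 - s) * b + (1 - s) ^ 2 * a ^ 2 := by
    rcases ha.eq_or_lt with h0 | h0
    · rw [← h0] at hb ⊢
      have : b = 0 := by nlinarith
      rw [this]
      linarith
    · have h1 : 0 ≤ (2 * b - (1 - s) * a ^ 2) ^ 2 := sq_nonneg _
      have h2 : 0 ≤ a ^ 2 * (4 * N - 4 * (1 - s) * b + (1 - s) ^ 2 * a ^ 2) := by nlinarith
      exact nonneg_of_mul_nonneg_right h2 (by positivity)
  have hA : W * a ^ 2 ≤ 4 * (W * (d + s / 2 * a) ^ 2) + 2 * (W * a * d)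
      - 4 * (W * (s * (d * a - b) + d ^ 2 - N)) - 2 * (W * ((s - 1) * a ^ 2 + 2 * b + a * d)) := by
    have := mul_nonneg hW hcs
    linarith
  have had : W * a * d ≤ 0 := mul_nonpos_of_nonneg_of_nonpos (by positivity) hd
  have hC : W * a * d ≤ -(l / β) * (R * W * (β * a + d)) - l ^ 2 / β * (W * R ^ 2 - W * R)
      + l * W * a := by
    have h1 : W * a * (l * (R - 1)) ≤ W * a * -d :=
      mul_le_mul_of_nonneg_left hlR (by positivity)
    have h2 : l / β * (R * W) * (l * (R - 1)) ≤ l / β * (R * W) * -d :=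
      mul_le_mul_of_nonneg_left hlR (by positivity)
    have h3 : l / β * (R * W * (β * a + d)) = l * R * W * a + l / β * (R * W) * d := by
      field_simp
    have h4 : l ^ 2 / β * (W * R ^ 2 - W * R) = l / β * (R * W) * (l * (R - 1)) := by ring
    rw [neg_mul, h3, h4]
    linarith
  have hD : l * W * a ≤ ε * (W * a ^ 2) + l ^ 2 * W / (4 * ε) := by
    have h1 : 0 ≤ W * (2 * ε * a - l) ^ 2 / (4 * ε) := by positivity
    have h2 : W * (2 * ε * a - l) ^ 2 / (4 * ε) =
        ε * (W * a ^ 2) + l ^ 2 * W / (4 * ε) - l * W * a := by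
      field_simp
      ring
    linarith
  have hB : γ ^ 2 * W * (d + s / 2 * a) ^ 2 =
      γ ^ 2 / q * (lam * (W * R ^ 2))
      - γ ^ 2 / q * (lam * (W * R ^ 2) - q * (W * (d ^ 2 + s * a * d)))
      + s ^ 2 / 4 * γ ^ 2 * (W * a ^ 2) := by
    field_simp
    ring
  have hsum : W * a ^ 2 ≤ (4 + 8 * ε) * (W * (d + s / 2 * a) ^ 2)
      - 2 * (l / β) * (R * W * (β * a + d)) - 2 * (l ^ 2 / β) * (W * R ^ 2 - W * R)
      + l ^ 2 * W / (2 * ε)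
      - (1 + 2 * ε) * (4 * (W * (s * (d * a - b) + d ^ 2 - N))
        + 2 * (W * ((s - 1) * a ^ 2 + 2 * b + a * d))) := by
    have hA' : ε * (W * a ^ 2) ≤ ε * (4 * (W * (d + s / 2 * a) ^ 2)
        - 4 * (W * (s * (d * a - b) + d ^ 2 - N))
        - 2 * (W * ((s - 1) * a ^ 2 + 2 * b + a * d))) :=
      mul_le_mul_of_nonneg_left (by linarith) hε.le
    have h5 : l ^ 2 * W / (2 * ε) = 2 * (l ^ 2 * W / (4 * ε)) := by
      field_simp
      norm_num
    rw [h5]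
    linarith
  have hfin := mul_le_mul_of_nonneg_left hsum (show 0 ≤ s ^ 2 / 4 * γ ^ 2 by positivity)
  have h6 : γ ^ 2 * s ^ 2 / (8 * ε) * l ^ 2 * W = s ^ 2 / 4 * γ ^ 2 * (l ^ 2 * W / (2 * ε)) := by
    field_simp
    ring
  rw [h6]
  linear_combination hfin + hB

end Estimates

section IntegralEstimate

variable {n : ℕ}

/-- The divergence of a vector field on `ℝⁿ`. -/
noncomputable def divergence (X : Fin n → EuclideanSpace ℝ (Fin n) → ℝ)
    (x : EuclideanSpace ℝ (Fin n)) : ℝ :=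
  ∑ i, pderiv i (X i) x

/-- The field `v ^ q ∇Δv - q v ^ (q - 1) Δv ∇v`. -/
noncomputable def bilaplacianField (v : EuclideanSpace ℝ (Fin n) → ℝ) (q : ℝ) (i : Fin n)
    (x : EuclideanSpace ℝ (Fin n)) : ℝ :=
  v x ^ q * pderiv i (lap v) x - q * (v x ^ (q - 1) * (lap v x * pderiv i v x))

/-- The field `v ^ s (Δv ∇v - ∇²v ∇v)`. -/
noncomputable def hessianField (v : EuclideanSpace ℝ (Fin n) → ℝ) (s : ℝ) (i : Fin n)
    (x : EuclideanSpace ℝ (Fin n)) : ℝ :=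
  v x ^ s * (lap v x * pderiv i v x - ∑ j, pderiv i (pderiv j v) x * pderiv j v x)

/-- The field `v ^ t |∇v|² ∇v`. -/
noncomputable def gradientField (v : EuclideanSpace ℝ (Fin n) → ℝ) (t : ℝ) (i : Fin n)
    (x : EuclideanSpace ℝ (Fin n)) : ℝ :=
  v x ^ t * ((∑ j, pderiv j v x ^ 2) * pderiv i v x)

/-- The field `v ^ β ∇v`. -/
noncomputable def powerField (v : EuclideanSpace ℝ (Fin n) → ℝ) (β : ℝ) (i : Fin n)
    (x : EuclideanSpace ℝ (Fin n)) : ℝ :=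
  v x ^ β * pderiv i v x

lemma continuous_divergence {X : Fin n → EuclideanSpace ℝ (Fin n) → ℝ}
    (hX : ∀ i, ContDiff ℝ 1 (X i)) : Continuous (divergence X) :=
  continuous_finsetSum _ fun i _ => ((hX i).pderiv (k := 0) (by simp) i).continuous

lemma contDiff_fields {v : EuclideanSpace ℝ (Fin n) → ℝ} (hv : ContDiff ℝ 4 v)
    (hpos : ∀ x, 0 < v x) (q s t β : ℝ) (i : Fin n) :
    ContDiff ℝ 1 (pderiv i (lap v)) ∧ ContDiff ℝ 1 (bilaplacianField v q i) ∧
      ContDiff ℝ 1 (hessianField v s i) ∧ ContDiff ℝ 1 (gradientField v t i) ∧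
      ContDiff ℝ 1 (powerField v β i) := by
  have hr : ∀ r : ℝ, ContDiff ℝ 1 (fun y => v y ^ r) := fun r =>
    (hv.of_le (by norm_num)).rpow_const_of_pos hpos r
  have hL : ContDiff ℝ 2 (lap v) := hv.lap (by norm_num)
  have hL1 : ContDiff ℝ 1 (lap v) := hL.of_le (by norm_num)
  have hLi : ContDiff ℝ 1 (pderiv i (lap v)) := hL.pderiv (by norm_num) i
  have hvi : ∀ j, ContDiff ℝ 1 (pderiv j v) := fun j => hv.pderiv (by norm_num) j
  have hvij : ∀ j, ContDiff ℝ 1 (pderiv i (pderiv j v)) := fun j =>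
    (hv.pderiv (k := 2) (by norm_num) j).pderiv (by norm_num) i
  exact ⟨hLi, ((hr q).mul hLi).sub (contDiff_const.mul ((hr _).mul (hL1.mul (hvi i)))),
    (hr s).mul ((hL1.mul (hvi i)).sub (ContDiff.sum fun j _ => (hvij j).mul (hvi j))),
    (hr t).mul ((ContDiff.sum fun j _ => (hvi j).pow 2).mul (hvi i)), (hr β).mul (hvi i)⟩

lemma abs_fields_le {v : EuclideanSpace ℝ (Fin n) → ℝ} (hv : ContDiff ℝ 4 v)
    {x : EuclideanSpace ℝ (Fin n)} (hx : v x = 1 ∧ lap v x = 0) {A : ℝ} (hA1 : 1 ≤ A)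
    (hA : ∀ k : ℕ, 1 ≤ k → k ≤ 3 → ‖iteratedFDeriv ℝ k v x‖ ≤ A) (q s t β : ℝ) (i : Fin n) :
    |pderiv i (lap v) x| ≤ (n + 1) * A ^ 3 ∧ |bilaplacianField v q i x| ≤ (n + 1) * A ^ 3 ∧
      |hessianField v s i x| ≤ (n + 1) * A ^ 3 ∧ |gradientField v t i x| ≤ (n + 1) * A ^ 3 ∧
      |powerField v β i x| ≤ (n + 1) * A ^ 3 := by
  have hA0 : 0 ≤ A := by linarith
  have hvi : ∀ j, |pderiv j v x| ≤ A := fun j =>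
    (abs_pderiv_le (hv.of_le (by norm_num)) j).trans (hA 1 le_rfl (by norm_num))
  have hvij : ∀ i j, |pderiv i (pderiv j v) x| ≤ A := fun i j =>
    (abs_pderiv_pderiv_le (hv.of_le (by norm_num)) i j).trans (hA 2 (by norm_num) (by norm_num))
  have hA13 : A ≤ A ^ 3 := le_self_pow₀ hA1 (by norm_num)
  have hA23 : A ^ 2 ≤ A ^ 3 := pow_le_pow_right₀ hA1 (by norm_num)
  have hn : (0 : ℝ) ≤ n := Nat.cast_nonneg n
  have hsum : ∀ {g : Fin n → ℝ} {m : ℕ}, m ≤ 3 → (∀ j, |g j| ≤ A ^ m) →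
      |∑ j, g j| ≤ (n + 1) * A ^ 3 := by
    intro g m hm hg
    calc |∑ j, g j| ≤ ∑ j, |g j| := Finset.abs_sum_le_sum_abs _ _
      _ ≤ ∑ _j : Fin n, A ^ 3 := Finset.sum_le_sum fun j _ =>
          (hg j).trans (pow_le_pow_right₀ hA1 hm)
      _ = n * A ^ 3 := by simp
      _ ≤ (n + 1) * A ^ 3 := by gcongr; linarith
  have h1 : |pderiv i (lap v) x| ≤ (n + 1) * A ^ 3 := by
    rw [← sum_pderiv_pderiv_pderiv (hv.of_le (by norm_num))]
    refine hsum (m := 1) (by norm_num) fun j => ?_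
    rw [pow_one]
    exact (abs_pderiv_pderiv_pderiv_le (hv.of_le (by norm_num)) j j i).trans
      (hA 3 (by norm_num) le_rfl)
  refine ⟨h1, ?_, ?_, ?_, ?_⟩
  · simpa [bilaplacianField, hx.1, hx.2] using h1
  · simp only [hessianField, hx.1, hx.2, one_rpow, zero_mul, zero_sub, one_mul, abs_neg]
    refine hsum (m := 2) (by norm_num) fun j => ?_
    rw [abs_mul, sq]
    exact mul_le_mul (hvij i j) (hvi j) (abs_nonneg _) hA0
  · simp only [gradientField, hx.1, one_rpow, one_mul, Finset.sum_mul]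
    refine hsum (m := 3) le_rfl fun j => ?_
    rw [abs_mul, abs_pow, pow_succ]
    exact mul_le_mul (pow_le_pow_left₀ (abs_nonneg _) (hvi j) 2) (hvi i) (abs_nonneg _)
      (sq_nonneg A)
  · simp only [powerField, hx.1, one_rpow, one_mul]
    have : 0 ≤ n * A ^ 3 := by positivity
    linarith [hvi i]

lemma mul_rpow_le_of_bilaplacian_eq {v : EuclideanSpace ℝ (Fin n) → ℝ} (hv : ContDiff ℝ 4 v)
    (hpos : ∀ x, 0 < v x) {x : EuclideanSpace ℝ (Fin n)} (hx1 : 1 ≤ v x)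
    {p γ q s α β l lam ε κ K c c' C : ℝ} (hs : s = 2 * (γ - 1)) (hs0 : 0 < s) (hα0 : 0 < α)
    (hα : p = 2 * α - 1) (hβ : β = s + α) (hq : q = 1 + s) (hl : 0 < l) (hlam : lam = l ^ 2 * α)
    (hε : 0 < ε) (hκ : κ = 1 - s ^ 2 - 2 * s ^ 2 * ε) (hκ0 : 0 ≤ κ) (hp : 0 ≤ p)
    (hc : c = γ ^ 2 * s ^ 2 / (2 * α * β)) (hc' : c' = γ ^ 2 * s ^ 2 / (8 * ε * α))
    (hK : 3 / 4 * K ≤ κ * p + c - γ ^ 2 / q) (hC : 0 ≤ C)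
    (hyoung : ∀ t : ℝ, 1 ≤ t →
      2 * κ * p * t ^ (p - 1 + γ) + c * t ^ β + c' * t ^ s ≤ K / 4 * t ^ (p + q) + C)
    (heq : lap (lap v) x = lam * v x ^ p) (hlow : l * (v x ^ α - 1) ≤ -lap v x) :
    lam * (K / 2) * v x ^ (p + q) ≤
      κ * (p * lam * (v x ^ (p - 1) * (v x ^ γ - 1) ^ 2) - lap (fun y => v y ^ γ) x ^ 2)
      + C * divergence (fun i => pderiv i (lap v)) x
      - γ ^ 2 / q * divergence (bilaplacianField v q) x
      - s ^ 2 * (1 + 2 * ε) * γ ^ 2 * divergence (hessianField v s) x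
      - s ^ 2 / 2 * (1 + 2 * ε) * γ ^ 2 * divergence (gradientField v (s - 1)) x
      - s ^ 2 * γ ^ 2 / 2 * (l / β) * divergence (powerField v β) x := by
  have hv2 : ContDiff ℝ 2 v := hv.of_le (by norm_num)
  have hvx := hpos x
  have hβ0 : 0 < β := by linarith
  have hq0 : 0 < q := by linarith
  have hlam0 : 0 < lam := by rw [hlam]; positivity
  set G := ∑ i, pderiv i v x ^ 2 with hG
  set H := ∑ i, ∑ j, pderiv i v x * pderiv j v x * pderiv i (pderiv j v) x with hH
  set N := ∑ i, ∑ j, pderiv i (pderiv j v) x ^ 2 with hN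
  set d := lap v x with hd
  set W := v x ^ s with hW
  set R := v x ^ α with hR
  have hG0 : 0 ≤ G := Finset.sum_nonneg fun _ _ => sq_nonneg _
  have hN0 : 0 ≤ N := Finset.sum_nonneg fun _ _ => Finset.sum_nonneg fun _ _ => sq_nonneg _
  have hW1 : v x ^ (s - 1) = W / v x := rpow_sub_one hvx.ne' s
  have hW2 : v x ^ (s - 1 - 1) = W / v x / v x := by rw [rpow_sub_one hvx.ne', hW1]
  have hU : v x ^ (p + q) = W * R ^ 2 := by
    rw [hW, hR, ← rpow_natCast (v x ^ α), ← rpow_mul hvx.le, ← rpow_add hvx]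
    congr 1
    push_cast
    linarith
  have hWR : v x ^ β = W * R := by rw [hW, hR, ← rpow_add hvx, hβ]
  have hz : lap (fun y => v y ^ γ) x ^ 2 = γ ^ 2 * W * (d + s / 2 * (G / v x)) ^ 2 := by
    have h1 : v x ^ (γ - 2) = v x ^ (γ - 1) / v x := by
      rw [← rpow_sub_one hvx.ne']
      ring_nf
    have h2 : W = (v x ^ (γ - 1)) ^ 2 := by
      rw [hW, ← rpow_natCast (v x ^ (γ - 1)), ← rpow_mul hvx.le, hs]
      congr 1
      push_cast
      ring
    rw [lap_rpow hv2 hpos, h1, h2, hs, ← hd, ← hG]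
    field_simp
  have hD1 : divergence (fun i => pderiv i (lap v)) x = lam * v x ^ p := by
    rw [← heq, lap_eq_sum_pderiv (hv.lap (by norm_num)), divergence]
  have hD2 : divergence (bilaplacianField v q) x =
      lam * (W * R ^ 2) - q * (W * (d ^ 2 + s * (G / v x) * d)) := by
    have h1 : v x ^ q * v x ^ p = W * R ^ 2 := by rw [← hU, ← rpow_add hvx, add_comm]
    have h := sum_pderiv_rpow_mul_pderiv_lap hv hpos q x
    rw [show q - 2 = s - 1 by linarith, show q - 1 = s by linarith, heq, hW1] at h
    unfold divergence bilaplacianField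
    rw [show q - 1 = s by linarith, h]
    linear_combination lam * h1
  have hD3 : divergence (hessianField v s) x =
      W * (s * (d * (G / v x) - H / v x) + d ^ 2 - N) := by
    have h := sum_pderiv_rpow_mul_hessian hv hpos s x
    rw [hW1] at h
    unfold divergence hessianField
    rw [h]
    ring
  have hD4 : divergence (gradientField v (s - 1)) x =
      W * ((s - 1) * (G / v x) ^ 2 + 2 * (H / v x) + G / v x * d) := by
    have h := sum_pderiv_rpow_mul_gradient_sq hv2 hpos (s - 1) x
    rw [hW2, hW1] at h
    unfold divergence gradientField
    rw [h]
    ring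
  have hD5 : divergence (powerField v β) x = R * W * (β * (G / v x) + d) := by
    have h := sum_pderiv_rpow_mul_pderiv hv2 hpos β x
    rw [rpow_sub_one hvx.ne', hWR] at h
    unfold divergence powerField
    rw [h]
    ring
  have hb : (H / v x) ^ 2 ≤ N * (G / v x) ^ 2 := by
    have h := sq_sum_sum_mul_pderiv_pderiv_le (v := v) x
    rw [div_pow, div_pow, ← mul_div_assoc, mul_comm N]
    gcongr
  have hmain := mul_sq_le_of_divergence_identities (lam := lam) (γ := γ) (s := s)
    (W := W) (by positivity) (a := G / v x)
    (by positivity) hb hN0 (one_le_rpow hx1 hα0.le) hl hlow hβ0 hq0 hε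
  rw [← hκ, ← hD2, ← hD3, ← hD4, ← hD5, ← hz, ← hU, ← hWR] at hmain
  have e1 : γ ^ 2 * s ^ 2 / 2 * (l ^ 2 / β) = lam * c := by
    rw [hc, hlam]
    field_simp
  have e2 : γ ^ 2 * s ^ 2 / (8 * ε) * l ^ 2 = lam * c' := by
    rw [hc', hlam]
    field_simp
  rw [e1, e2] at hmain
  have hJ : v x ^ (p + q) - 2 * v x ^ (p - 1 + γ) ≤ v x ^ (p - 1) * (v x ^ γ - 1) ^ 2 := by
    have h1 : v x ^ (p + q) = v x ^ (p - 1) * (v x ^ γ) ^ 2 := by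
      rw [← rpow_natCast (v x ^ γ), ← rpow_mul hvx.le, ← rpow_add hvx]
      congr 1
      push_cast
      linarith
    have h2 : v x ^ (p - 1 + γ) = v x ^ (p - 1) * v x ^ γ := rpow_add hvx _ _
    have h3 : 0 < v x ^ (p - 1) := rpow_pos_of_pos hvx _
    rw [h1, h2]
    linarith
  have hJ' := mul_le_mul_of_nonneg_left hJ (show 0 ≤ κ * (p * lam) by positivity)
  have hY := mul_le_mul_of_nonneg_left (hyoung _ hx1) hlam0.le
  have hone : C * lam ≤ C * divergence (fun i => pderiv i (lap v)) x := by
    rw [hD1]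
    have : 1 ≤ v x ^ p := one_le_rpow hx1 hp
    have := mul_le_mul_of_nonneg_left this hlam0.le
    gcongr
    linarith
  have hK' := mul_le_mul_of_nonneg_right hK (show 0 ≤ lam * v x ^ (p + q) by positivity)
  linarith

end IntegralEstimate

section Final

variable {n : ℕ} {Ω : Set (EuclideanSpace ℝ (Fin n))}

lemma Continuous.integrableOn_of_isBounded {f : EuclideanSpace ℝ (Fin n) → ℝ} (hf : Continuous f)
    (hb : Bornology.IsBounded Ω) : IntegrableOn f Ω :=
  (hf.continuousOn.integrableOn_compact hb.isCompact_closure).mono_set subset_closure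

lemma sum_mul_setIntegral_nonneg {m : ℕ} (ho : IsOpen Ω) (hb : Bornology.IsBounded Ω)
    (c : Fin m → ℝ) {f : Fin m → EuclideanSpace ℝ (Fin n) → ℝ} (hf : ∀ k, Continuous (f k))
    (h : ∀ x ∈ Ω, 0 ≤ ∑ k, c k * f k x) : 0 ≤ ∑ k, c k * ∫ x in Ω, f k x := by
  simp_rw [← integral_const_mul]
  rw [← integral_finsetSum _ fun k _ => ((hf k).integrableOn_of_isBounded hb).const_mul (c k)]
  exact setIntegral_nonneg ho.measurableSet h

/-- The derivative bounds on the boundary control the divergence integrals uniformly. -/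
lemma exists_abs_setIntegral_divergence_le (ho : IsOpen Ω) (hb : Bornology.IsBounded Ω)
    (hc : Convex ℝ Ω) {A : ℝ} (hA1 : 1 ≤ A) :
    ∃ T, 0 ≤ T ∧ ∀ v : EuclideanSpace ℝ (Fin n) → ℝ, ContDiff ℝ 4 v → (∀ x, 0 < v x) →
      (∀ x ∈ frontier Ω, v x = 1 ∧ lap v x = 0) →
      (∀ x ∈ frontier Ω, ∀ k : ℕ, 1 ≤ k → k ≤ 3 → ‖iteratedFDeriv ℝ k v x‖ ≤ A) →
      ∀ q s t β : ℝ, |∫ x in Ω, divergence (fun i => pderiv i (lap v)) x| ≤ T ∧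
        |∫ x in Ω, divergence (bilaplacianField v q) x| ≤ T ∧
        |∫ x in Ω, divergence (hessianField v s) x| ≤ T ∧
        |∫ x in Ω, divergence (gradientField v t) x| ≤ T ∧
        |∫ x in Ω, divergence (powerField v β) x| ≤ T := by
  obtain ⟨κ, hκ, h⟩ := exists_abs_setIntegral_div_le ho hb hc
  have hM : 0 ≤ (n + 1) * A ^ 3 := by
    have : 0 ≤ A := by linarith
    positivity
  refine ⟨κ * ((n + 1) * A ^ 3), by positivity, fun v hv hpos hbd hA q s t β => ?_⟩
  have hC := contDiff_fields hv hpos q s t β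
  have hB := fun x hx => abs_fields_le hv (hbd x hx) hA1 (hA x hx) q s t β
  exact ⟨h _ (fun i => (hC i).1) _ hM fun i x hx => (hB x hx i).1,
    h _ (fun i => (hC i).2.1) _ hM fun i x hx => (hB x hx i).2.1,
    h _ (fun i => (hC i).2.2.1) _ hM fun i x hx => (hB x hx i).2.2.1,
    h _ (fun i => (hC i).2.2.2.1) _ hM fun i x hx => (hB x hx i).2.2.2.1,
    h _ (fun i => (hC i).2.2.2.2) _ hM fun i x hx => (hB x hx i).2.2.2.2⟩

/-- A stable solution `u` is represented near `closure Ω` by `v - 1`, with `v` globally positive. -/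
lemma IsStableSol.exists_pos_extension (ho : IsOpen Ω) {p lam : ℝ}
    {u : EuclideanSpace ℝ (Fin n) → ℝ} (hu : IsStableSol Ω p lam u) :
    ∃ v : EuclideanSpace ℝ (Fin n) → ℝ, ContDiff ℝ 4 v ∧ (∀ x, 0 < v x) ∧
      (∀ x ∈ closure Ω, v x = u x + 1) ∧ (∀ x ∈ Ω, 1 ≤ v x) ∧
      (∀ x ∈ Ω, lap (lap v) x = lam * v x ^ p) ∧
      (∀ x ∈ frontier Ω, v x = 1 ∧ lap v x = 0) ∧
      ∀ x ∈ frontier Ω, ∀ k : ℕ, 1 ≤ k →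
        ‖iteratedFDeriv ℝ k v x‖ = ‖iteratedFDeriv ℝ k u x‖ := by
  obtain ⟨hu4, hupos, heq, hbdry, -⟩ := hu
  have hcl : ∀ x ∈ closure Ω, 0 ≤ u x := by
    intro x hx
    by_cases h : x ∈ Ω
    · exact (hupos x h).le
    · exact (hbdry x (by rw [ho.frontier_eq]; exact ⟨hx, h⟩)).1.ge
  obtain ⟨v, hv, hpos, hev⟩ := exists_pos_contDiff_eventuallyEq_add_one (m := 4) hu4 hcl
  have hfd : fderiv ℝ (fun y => u y + 1) = fderiv ℝ u := by
    ext1 y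
    exact fderiv_add_const 1
  have hlapu : ∀ x, lap (fun y => u y + 1) x = lap u x := by
    intro x
    have hu2 : ContDiff ℝ 2 u := hu4.of_le (by norm_num)
    rw [lap_eq_sum_pderiv (hu2.add contDiff_const), lap_eq_sum_pderiv hu2]
    have hpd : ∀ i, pderiv i (fun y => u y + 1) = pderiv i u := fun i => by
      ext y
      simp only [pderiv, hfd]
    simp only [hpd]
  have hlap : ∀ x ∈ closure Ω, lap v =ᶠ[nhds x] lap u := fun x hx => by
    filter_upwards [(hev x hx).eventuallyEq_nhds] with y hy
    rw [hy.lap_eq, hlapu]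
  have hval : ∀ x ∈ closure Ω, v x = u x + 1 := fun x hx => (hev x hx).eq_of_nhds
  refine ⟨v, hv, hpos, hval, fun x hx => ?_, fun x hx => ?_, fun x hx => ?_, fun x hx k hk => ?_⟩
  · rw [hval x (subset_closure hx)]
    linarith [hupos x hx]
  · rw [(hlap x (subset_closure hx)).lap_eq, heq x hx, hval x (subset_closure hx)]
  · have hx' := frontier_subset_closure hx
    rw [hval x hx', (hlap x hx').eq_of_nhds, (hbdry x hx).1, (hbdry x hx).2]
    simp
  · obtain ⟨k, rfl⟩ := Nat.exists_eq_add_of_le' hk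
    rw [((hev x (frontier_subset_closure hx)).iteratedFDeriv ℝ (k + 1)).eq_of_nhds,
      ← norm_iteratedFDeriv_fderiv, hfd, norm_iteratedFDeriv_fderiv]

end Final

theorem stmt_17 (n : ℕ) (Ω : Set (EuclideanSpace ℝ (Fin n)))
    (hopen : IsOpen Ω) (hbdd : Bornology.IsBounded Ω) (hconv : Convex ℝ Ω)
    (hsmooth : ∃ f : EuclideanSpace ℝ (Fin n) → ℝ, ContDiff ℝ (⊤ : ℕ∞) f ∧
      Ω = f ⁻¹' Set.Iio 0 ∧ frontier Ω = f ⁻¹' {0} ∧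
      ∀ x ∈ frontier Ω, gradient f x ≠ 0)
    (p : ℝ) (hp : 1 < p) (γ q : ℝ) (hγ1 : 1 < γ) (hγ2 : γ < 3/2) (hq : q = 2*γ - 1)
    (hpos1 : 0 < 1 - 4*(γ-1)^2)
    (hpos2 : 0 < p*(1 - 4*(γ-1)^2) + 8*γ^2*(γ-1)^2/((4*γ+p-3)*(p+1)) - γ^2/(2*γ-1))
    (C₀ : ℝ)
    (hbnd : ∀ lam : ℝ, 0 < lam → ∀ u, IsStableSol Ω p lam u →
      ∀ x ∈ frontier Ω, ∀ k : ℕ, k ≤ 4 → ‖iteratedFDeriv ℝ k u x‖ ≤ C₀) :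
    ∃ C > 0, ∀ lam : ℝ, 0 < lam → ∀ u, IsStableSol Ω p lam u →
      (p*(1 - 4*(γ-1)^2) + 8*γ^2*(γ-1)^2/((4*γ+p-3)*(p+1)) - γ^2/(2*γ-1)) *
          ∫ x in Ω, (u x + 1) ^ (p+q) ≤ C / lam := by
  rcases Ω.eq_empty_or_nonempty with rfl | hne
  · exact ⟨1, one_pos, fun lam hlam u _ => by simpa using hlam.le⟩
  obtain ⟨s, hs⟩ : ∃ s, s = 2 * (γ - 1) := ⟨_, rfl⟩
  obtain ⟨α, hα⟩ : ∃ α, α = (p + 1) / 2 := ⟨_, rfl⟩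
  obtain ⟨β, hβ⟩ : ∃ β, β = s + α := ⟨_, rfl⟩
  have hs0 : 0 < s := by linarith
  have hα0 : 0 < α := by linarith
  have hβ0 : 0 < β := by linarith
  have hqs : q = 1 + s := by linarith
  have hq0 : 0 < q := by linarith
  have hp0 : 0 < p := by linarith
  have hs1 : 0 < 1 - s ^ 2 := by rw [hs]; linarith
  obtain ⟨c, hc⟩ : ∃ c, c = γ ^ 2 * s ^ 2 / (2 * α * β) := ⟨_, rfl⟩
  have hKeq : p*(1 - 4*(γ-1)^2) + 8*γ^2*(γ-1)^2/((4*γ+p-3)*(p+1)) - γ^2/(2*γ-1) =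
      p * (1 - s ^ 2) + c - γ ^ 2 / q := by
    have h1 : 2 * α * β = (4*γ+p-3)*(p+1) / 2 := by rw [hβ, hα, hs]; ring
    rw [hc, h1, hq, hs]
    have h2 : 4*γ+p-3 ≠ 0 := by linarith
    have h3 : p + 1 ≠ 0 := by linarith
    have h4 : 2 * γ - 1 ≠ 0 := by linarith
    field_simp
    ring
  rw [hKeq] at hpos2 ⊢
  set K := p * (1 - s ^ 2) + c - γ ^ 2 / q with hK
  obtain ⟨ε, hε, hεK, hε1⟩ : ∃ ε, 0 < ε ∧ 2 * s ^ 2 * ε * p ≤ K / 4 ∧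
      2 * s ^ 2 * ε ≤ (1 - s ^ 2) / 2 := by
    refine ⟨min (K / (8 * s ^ 2 * p)) ((1 - s ^ 2) / (4 * s ^ 2)), by positivity, ?_, ?_⟩
    · calc 2 * s ^ 2 * min (K / (8 * s ^ 2 * p)) ((1 - s ^ 2) / (4 * s ^ 2)) * p
          ≤ 2 * s ^ 2 * (K / (8 * s ^ 2 * p)) * p := by gcongr; exact min_le_left _ _
        _ = K / 4 := by field_simp; norm_num
    · calc 2 * s ^ 2 * min (K / (8 * s ^ 2 * p)) ((1 - s ^ 2) / (4 * s ^ 2))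
          ≤ 2 * s ^ 2 * ((1 - s ^ 2) / (4 * s ^ 2)) := by gcongr; exact min_le_right _ _
        _ = (1 - s ^ 2) / 2 := by field_simp; norm_num
  obtain ⟨κ, hκ⟩ : ∃ κ, κ = 1 - s ^ 2 - 2 * s ^ 2 * ε := ⟨_, rfl⟩
  obtain ⟨c', hc'⟩ : ∃ c', c' = γ ^ 2 * s ^ 2 / (8 * ε * α) := ⟨_, rfl⟩
  have hκ0 : 0 ≤ κ := by linarith
  have hc0 : 0 ≤ c := by rw [hc]; positivity
  have hc'0 : 0 ≤ c' := by rw [hc']; positivity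
  have hK34 : 3 / 4 * K ≤ κ * p + c - γ ^ 2 / q := by
    have : κ * p = p * (1 - s ^ 2) - 2 * s ^ 2 * ε * p := by rw [hκ]; ring
    linarith
  obtain ⟨C₁, hC₁, hy₁⟩ := exists_mul_rpow_le (r := p - 1 + γ) (m := p + q) (by linarith)
    (by linarith) (show 0 ≤ 2 * κ * p by positivity) (show 0 < K / 12 by positivity)
  obtain ⟨C₂, hC₂, hy₂⟩ := exists_mul_rpow_le (r := β) (m := p + q) hβ0.le
    (by linarith) hc0 (show 0 < K / 12 by positivity)
  obtain ⟨C₃, hC₃, hy₃⟩ := exists_mul_rpow_le (r := s) (m := p + q) hs0.le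
    (by linarith) hc'0 (show 0 < K / 12 by positivity)
  have hyoung : ∀ t : ℝ, 1 ≤ t → 2 * κ * p * t ^ (p - 1 + γ) + c * t ^ β + c' * t ^ s ≤
      K / 4 * t ^ (p + q) + (C₁ + C₂ + C₃) := fun t ht => by
    linarith [hy₁ t ht, hy₂ t ht, hy₃ t ht]
  have hA1 : 1 ≤ 1 + |C₀| := by linarith [abs_nonneg C₀]
  obtain ⟨T, hT, hdiv⟩ := exists_abs_setIntegral_divergence_le hopen hbdd hconv hA1
  have hvol : 0 < volume.real Ω :=
    ENNReal.toReal_pos (hopen.measure_pos volume hne).ne' hbdd.measure_lt_top.ne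
  set l₀ := √(T / volume.real Ω / α) with hl₀
  refine ⟨2 * T * (C₁ + C₂ + C₃ + γ ^ 2 / q + s ^ 2 * (1 + 2 * ε) * γ ^ 2
    + s ^ 2 / 2 * (1 + 2 * ε) * γ ^ 2 + s ^ 2 * γ ^ 2 / 2 * (l₀ / β)) + 1, by positivity,
    fun lam hlam u hu => ?_⟩
  obtain ⟨v, hv, hpos, hval, hv1, heq, hbdry, hder⟩ := hu.exists_pos_extension hopen
  have hder' : ∀ x ∈ frontier Ω, ∀ k : ℕ, 1 ≤ k → k ≤ 3 →
      ‖iteratedFDeriv ℝ k v x‖ ≤ 1 + |C₀| := fun x hx k hk1 hk3 => by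
    rw [hder x hx k hk1]
    linarith [hbnd lam hlam u hu x hx k (by omega), le_abs_self C₀]
  obtain ⟨hT1, hT2, hT3, hT4, hT5⟩ := hdiv v hv hpos hbdry hder' q s (s - 1) β
  have hfields := contDiff_fields hv hpos q s (s - 1) β
  obtain ⟨l, hl⟩ : ∃ l, l = √(lam / α) := ⟨_, rfl⟩
  have hl0 : 0 < l := by rw [hl]; positivity
  have hlam' : lam = l ^ 2 * α := by
    rw [hl, sq_sqrt (by positivity)]
    field_simp
  have hlow := mul_rpow_sub_one_le_neg_lap hopen hbdd hv hpos (α := α) (by linarith)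
    (show 2 * α - 1 = p by linarith) hl0 hlam'.symm heq hbdry
  have hr : ∀ r : ℝ, Continuous fun y => v y ^ r := fun r =>
    (hv.rpow_const_of_pos hpos r).continuous
  have hw : ContDiff ℝ 2 (fun y => v y ^ γ - 1) :=
    ((hv.of_le (by norm_num)).rpow_const_of_pos hpos γ).sub contDiff_const
  have hlapw : lap (fun y => v y ^ γ - 1) = lap (fun y => v y ^ γ) := by
    ext x
    rw [lap_sub ((hv.of_le (by norm_num)).rpow_const_of_pos hpos γ) contDiff_const]
    simp [lap, iteratedFDeriv_const_of_ne]
  have hstab := hu.le_setIntegral_lap_sq hopen hbdd hconv hsmooth hne hp hw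
    (fun x hx => by simp [(hbdry x hx).1])
  rw [hlapw] at hstab
  have hJ : ∫ x in Ω, (u x + 1) ^ (p - 1) * (v x ^ γ - 1) ^ 2 =
      ∫ x in Ω, v x ^ (p - 1) * (v x ^ γ - 1) ^ 2 :=
    setIntegral_congr_fun hopen.measurableSet fun x hx => by
      simp only [hval x (subset_closure hx)]
  have hU : ∫ x in Ω, (u x + 1) ^ (p + q) = ∫ x in Ω, v x ^ (p + q) :=
    setIntegral_congr_fun hopen.measurableSet fun x hx => by
      simp only [hval x (subset_closure hx)]
  rw [hJ] at hstab
  rw [hU]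
  have hlamT : lam * volume.real Ω ≤ T := by
    have h := sum_mul_setIntegral_nonneg hopen hbdd ![1, -lam]
      (f := ![divergence (fun i => pderiv i (lap v)), fun _ => 1])
      (by
        simp only [Fin.forall_fin_succ, Matrix.cons_val_zero]
        exact ⟨continuous_divergence fun i => (hfields i).1, continuous_const, fun i => i.elim0⟩)
      (fun x hx => by
        have h1 : divergence (fun i => pderiv i (lap v)) x = lam * v x ^ p := by
          rw [← heq x hx, lap_eq_sum_pderiv (hv.lap (by norm_num)), divergence]
        have h2 := mul_le_mul_of_nonneg_left (one_le_rpow (hv1 x hx) hp0.le) hlam.le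
        simp [Fin.sum_univ_succ, h1]
        linarith)
    simp [Fin.sum_univ_succ] at h
    linarith [le_abs_self (∫ x in Ω, divergence (fun i => pderiv i (lap v)) x)]
  have hll₀ : l ≤ l₀ := by
    rw [hl, hl₀]
    gcongr
    rwa [le_div_iff₀ hvol]
  have hmain := sum_mul_setIntegral_nonneg hopen hbdd ![-(lam * (K / 2)), κ * (p * lam), -κ,
      C₁ + C₂ + C₃, -(γ ^ 2 / q), -(s ^ 2 * (1 + 2 * ε) * γ ^ 2),
      -(s ^ 2 / 2 * (1 + 2 * ε) * γ ^ 2), -(s ^ 2 * γ ^ 2 / 2 * (l / β))]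
    (f := ![fun x => v x ^ (p + q), fun x => v x ^ (p - 1) * (v x ^ γ - 1) ^ 2,
      fun x => lap (fun y => v y ^ γ) x ^ 2, divergence (fun i => pderiv i (lap v)),
      divergence (bilaplacianField v q), divergence (hessianField v s),
      divergence (gradientField v (s - 1)), divergence (powerField v β)])
    (by
      simp only [Fin.forall_fin_succ]
      exact ⟨hr _, (hr _).mul (((hr _).sub continuous_const).pow 2),
        (((hv.rpow_const_of_pos hpos γ).lap (k := 0) (by norm_num)).continuous).pow 2,
        continuous_divergence fun i => (hfields i).1,
        continuous_divergence fun i => (hfields i).2.1,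
        continuous_divergence fun i => (hfields i).2.2.1,
        continuous_divergence fun i => (hfields i).2.2.2.1,
        continuous_divergence fun i => (hfields i).2.2.2.2, fun i => i.elim0⟩)
    (fun x hx => by
      have h := mul_rpow_le_of_bilaplacian_eq hv hpos (hv1 x hx) hs hs0 hα0 (by linarith) hβ hqs
        hl0 hlam' hε hκ hκ0 hp0.le hc hc' hK34 (by positivity) hyoung (heq x hx)
        (hlow x (subset_closure hx))
      simp [Fin.sum_univ_succ]
      linarith)
  simp [Fin.sum_univ_succ] at hmain
  have hst := mul_le_mul_of_nonneg_left hstab hκ0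
  have hb1 := mul_le_mul_of_nonneg_left (abs_le.1 hT1).2 (show 0 ≤ C₁ + C₂ + C₃ by positivity)
  have hb2 := mul_le_mul_of_nonneg_left (abs_le.1 hT2).1 (show 0 ≤ γ ^ 2 / q by positivity)
  have hb3 := mul_le_mul_of_nonneg_left (abs_le.1 hT3).1
    (show 0 ≤ s ^ 2 * (1 + 2 * ε) * γ ^ 2 by positivity)
  have hb4 := mul_le_mul_of_nonneg_left (abs_le.1 hT4).1
    (show 0 ≤ s ^ 2 / 2 * (1 + 2 * ε) * γ ^ 2 by positivity)
  have hb5 := mul_le_mul_of_nonneg_left (abs_le.1 hT5).1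
    (show 0 ≤ s ^ 2 * γ ^ 2 / 2 * (l / β) by positivity)
  have hb6 : s ^ 2 * γ ^ 2 / 2 * (l / β) * T ≤ s ^ 2 * γ ^ 2 / 2 * (l₀ / β) * T := by gcongr
  rw [le_div_iff₀ hlam]
  linarith
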